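/- Let Ω⁺ ⊂ ℝ³ be a non-empty bounded open set and let 0 < λ ≤ |Ω⁺|. Then the constrained minimization problem min{ E(Ω⁻) : Ω⁻ ⊂ ℝ³ measurable, |Ω⁺ ∩ Ω⁻| = 0, |Ω⁻| = λ } admits a minimizer, and the minimizer is unique up to a set of Lebesgue measure zero. -/

import Mathlib

open MeasureTheory Real

noncomputable section

abbrev E3 := EuclideanSpace ℝ (Fin 3)

/-- The Coulomb kernel in ℝ³. -/
def coul (x y : E3) : ℝ := 1 / (4 * π * ‖x - y‖)

/-- The Coulomb energy `E(Ω⁻)` of a negative phase `Ωm` in the field of the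
positive phase `Ωp`. -/
def energy (Ωp Ωm : Set E3) : ℝ :=
  (∫ x in Ωp, ∫ y in Ωp, coul x y) + (∫ x in Ωm, ∫ y in Ωm, coul x y)
    - 2 * ∫ x in Ωp, ∫ y in Ωm, coul x y

/-- Admissible configurations for the constrained problem with volume `λ`. -/
def AdmC (Ωp : Set E3) (lam : ℝ) (Ωm : Set E3) : Prop :=
  MeasurableSet Ωm ∧ volume (Ωp ∩ Ωm) = 0 ∧ volume Ωm = ENNReal.ofReal lam

open Filter Topology Set Metric

/-- The Newtonian kernel in `ℝ³`. -/
def newt (z : E3) : ℝ := 1 / (4 * π * ‖z‖)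

lemma coul_eq_newt (x y : E3) : coul x y = newt (x - y) := rfl

lemma newt_nonneg (z : E3) : 0 ≤ newt z := by unfold newt; positivity

lemma coul_nonneg (x y : E3) : 0 ≤ coul x y := newt_nonneg _

lemma coul_comm (x y : E3) : coul x y = coul y x := by
  simp only [coul, norm_sub_rev]

lemma measurable_newt : Measurable newt := by unfold newt; fun_prop

lemma measurable_coul : Measurable (fun p : E3 × E3 => coul p.1 p.2) :=
  measurable_newt.comp (measurable_fst.sub measurable_snd)

lemma newt_le {R : ℝ} (hR : 0 < R) {z : E3} (hz : R ≤ ‖z‖) : newt z ≤ 1 / (4 * π * R) := by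
  unfold newt; gcongr

lemma newt_smul {h : ℝ} (hh : 0 < h) (z : E3) : newt (h • z) = h⁻¹ * newt z := by
  simp only [newt, norm_smul, norm_eq_abs, abs_of_pos hh]
  rw [one_div, one_div, ← mul_inv]; congr 1; ring

lemma integrableOn_newt_sq (R : ℝ) : IntegrableOn (fun z => newt z ^ 2) (ball 0 R) := by
  have := (integrableOn_fun_norm_addHaar (volume : Measure E3) (r := R)
    (f := fun t : ℝ => (1 / (4 * π * t)) ^ 2)).2
  refine this ?_
  have h2 : IntegrableOn (fun _ : ℝ => (1 / (4 * π)) ^ 2) (Ioo 0 R) :=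
    integrableOn_const (by simp)
  refine h2.congr_fun (fun t ht => ?_) measurableSet_Ioo
  have ht0 : t ≠ 0 := ne_of_gt ht.1
  simp
  field_simp

lemma integrableOn_newt (R : ℝ) : IntegrableOn newt (ball 0 R) := by
  have h := (integrableOn_newt_sq R).add (g := fun _ => (1 : ℝ))
    (integrableOn_const measure_ball_lt_top.ne)
  refine h.mono' measurable_newt.aestronglyMeasurable (ae_of_all _ fun z => ?_)
  rw [norm_of_nonneg (newt_nonneg z)]
  simp only [Pi.add_apply]
  nlinarith [sq_nonneg (newt z - 1), newt_nonneg z]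

/-- The charge densities considered: integrable and square integrable functions. -/
def Charge (ρ : E3 → ℝ) : Prop := Integrable ρ ∧ MemLp ρ 2

namespace Charge

variable {ρ σ : E3 → ℝ}

lemma add (hρ : Charge ρ) (hσ : Charge σ) : Charge (fun x => ρ x + σ x) :=
  ⟨hρ.1.add hσ.1, hρ.2.add hσ.2⟩

lemma sub (hρ : Charge ρ) (hσ : Charge σ) : Charge (fun x => ρ x - σ x) :=
  ⟨hρ.1.sub hσ.1, hρ.2.sub hσ.2⟩

lemma const_mul (hρ : Charge ρ) (c : ℝ) : Charge (fun x => c * ρ x) :=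
  ⟨hρ.1.const_mul c, hρ.2.const_mul c⟩

lemma abs (hρ : Charge ρ) : Charge (fun x => |ρ x|) := ⟨hρ.1.abs, hρ.2.abs⟩

lemma congr (hρ : Charge ρ) (h : ρ =ᵐ[volume] σ) : Charge σ :=
  ⟨hρ.1.congr h, hρ.2.ae_eq h⟩

lemma of_bound (hρ : Integrable ρ) {C : ℝ} (hC : ∀ᵐ x, |ρ x| ≤ C) : Charge ρ := by
  refine ⟨hρ, (memLp_two_iff_integrable_sq hρ.1).2 ?_⟩
  refine (hρ.abs.const_mul C).mono' (hρ.1.pow 2) ?_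
  filter_upwards [hC] with x hx
  rw [norm_of_nonneg (sq_nonneg _), ← sq_abs]
  nlinarith [abs_nonneg (ρ x)]

end Charge

lemma integrableOn_ball_indicator (x : E3) (R : ℝ) :
    Integrable (fun y => (ball (0 : E3) R).indicator (fun z => newt z ^ 2) (x - y)) :=
  ((integrableOn_newt_sq R).integrable_indicator measurableSet_ball).comp_sub_left x

lemma coul_mul_abs_le (x y : E3) (v : ℝ) {R ε : ℝ} (hR : 0 < R) (hε : 0 < ε) :
    coul x y * |v| ≤ ε / 2 * (ball (0 : E3) R).indicator (fun z => newt z ^ 2) (x - y)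
      + 1 / (2 * ε) * v ^ 2 + 1 / (4 * π * R) * |v| := by
  have hv : 0 ≤ 1 / (2 * ε) * v ^ 2 := by positivity
  by_cases h : x - y ∈ ball (0 : E3) R
  · rw [indicator_of_mem h, coul_eq_newt]
    have h3 : 0 ≤ 1 / (4 * π * R) * |v| := by positivity
    have h4 : ε / 2 * newt (x - y) ^ 2 + 1 / (2 * ε) * v ^ 2 - newt (x - y) * |v|
        = 1 / (2 * ε) * (ε * newt (x - y) - |v|) ^ 2 := by
      rw [← sq_abs v]; field_simp; ring
    have h5 : 0 ≤ 1 / (2 * ε) * (ε * newt (x - y) - |v|) ^ 2 := by positivity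
    linarith
  · rw [indicator_of_notMem h, coul_eq_newt]
    have : newt (x - y) ≤ 1 / (4 * π * R) := newt_le hR (by simpa using h)
    have := mul_le_mul_of_nonneg_right this (abs_nonneg v)
    linarith

lemma Charge.integrable_coul_mul {v : E3 → ℝ} (hv : Charge v) (x : E3) :
    Integrable (fun y => coul x y * v y) := by
  have h := ((integrableOn_ball_indicator x 1).const_mul (1 / 2)).add
    ((hv.2.integrable_sq.const_mul (1 / (2 * 1))).add (hv.1.abs.const_mul (1 / (4 * π * 1))))
  refine h.mono' ?_ (ae_of_all _ fun y => ?_)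
  · exact ((measurable_coul.comp measurable_prodMk_left).aestronglyMeasurable).mul hv.1.1
  · rw [norm_mul, norm_of_nonneg (coul_nonneg x y), norm_eq_abs]
    have := coul_mul_abs_le x y (v y) one_pos one_pos
    simp only [Pi.add_apply]
    linarith

lemma Charge.integral_coul_mul_abs_le {v : E3 → ℝ} (hv : Charge v) (x : E3) {R ε : ℝ}
    (hR : 0 < R) (hε : 0 < ε) :
    ∫ y, coul x y * |v y| ≤ ε / 2 * (∫ z in ball (0 : E3) R, newt z ^ 2)
      + 1 / (2 * ε) * (∫ y, v y ^ 2) + 1 / (4 * π * R) * ∫ y, |v y| := by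
  have h1 := (integrableOn_ball_indicator x R).const_mul (ε / 2)
  have h2 := hv.2.integrable_sq.const_mul (1 / (2 * ε))
  have h3 := hv.1.abs.const_mul (1 / (4 * π * R))
  have h12 : Integrable fun y => ε / 2 * (ball (0 : E3) R).indicator (fun z => newt z ^ 2) (x - y)
      + 1 / (2 * ε) * v y ^ 2 := h1.add h2
  calc ∫ y, coul x y * |v y| ≤ ∫ y, (ε / 2 * (ball (0 : E3) R).indicator
        (fun z => newt z ^ 2) (x - y) + 1 / (2 * ε) * v y ^ 2 + 1 / (4 * π * R) * |v y|) :=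
        integral_mono (hv.abs.integrable_coul_mul x) (h12.add h3)
          fun y => coul_mul_abs_le x y (v y) hR hε
    _ = _ := by
        rw [integral_add h12 h3, integral_add h1 h2, integral_const_mul,
          integral_const_mul, integral_const_mul,
          integral_sub_left_eq_self (fun z => (ball (0 : E3) R).indicator (fun z => newt z ^ 2) z),
          integral_indicator measurableSet_ball]

/-- The Coulomb potential of a charge density. -/
def pot (ρ : E3 → ℝ) (x : E3) : ℝ := ∫ y, coul x y * ρ y

lemma abs_pot_le (ρ : E3 → ℝ) (x : E3) : |pot ρ x| ≤ ∫ y, coul x y * |ρ y| := by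
  refine (abs_integral_le_integral_abs).trans (le_of_eq ?_)
  simp only [abs_mul, abs_of_nonneg (coul_nonneg _ _)]

lemma Charge.exists_pot_bound {ρ : E3 → ℝ} (hρ : Charge ρ) :
    ∃ C, 0 ≤ C ∧ ∀ x, ∫ y, coul x y * |ρ y| ≤ C :=
  ⟨_, (integral_nonneg fun y => mul_nonneg (coul_nonneg 0 y) (abs_nonneg _)).trans
    (hρ.integral_coul_mul_abs_le 0 one_pos one_pos),
    fun x => hρ.integral_coul_mul_abs_le x one_pos one_pos⟩

lemma aestronglyMeasurable_coul_mul {ρ : E3 → ℝ} (hρ : AEStronglyMeasurable ρ) :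
    AEStronglyMeasurable (fun p : E3 × E3 => coul p.1 p.2 * ρ p.2) (volume.prod volume) :=
  measurable_coul.aestronglyMeasurable.mul hρ.comp_snd

lemma Charge.aestronglyMeasurable_pot {ρ : E3 → ℝ} (hρ : Charge ρ) :
    AEStronglyMeasurable (pot ρ) :=
  (aestronglyMeasurable_coul_mul hρ.1.1).integral_prod_right'

lemma measurable_pot {ρ : E3 → ℝ} (hρ : Measurable ρ) : Measurable (pot ρ) :=
  ((measurable_coul.mul (hρ.comp measurable_snd)).stronglyMeasurable.integral_prod_right
    (ν := volume)).measurable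

lemma Charge.integrable_mul_pot {ρ σ : E3 → ℝ} (hρ : Charge ρ) (hσ : Integrable σ) :
    Integrable (fun x => σ x * pot ρ x) := by
  obtain ⟨C, -, hC⟩ := hρ.exists_pot_bound
  exact hσ.mul_bdd (c := C) hρ.aestronglyMeasurable_pot
    (ae_of_all _ fun x => (abs_pot_le ρ x).trans (hC x))

lemma Charge.integrable_prod {ρ σ : E3 → ℝ} (hρ : Charge ρ) (hσ : Charge σ) :
    Integrable (fun p : E3 × E3 => ρ p.1 * (coul p.1 p.2 * σ p.2)) (volume.prod volume) := by
  have hm : AEStronglyMeasurable (fun p : E3 × E3 => ρ p.1 * (coul p.1 p.2 * σ p.2))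
      (volume.prod volume) := hρ.1.1.comp_fst.mul (aestronglyMeasurable_coul_mul hσ.1.1)
  refine (integrable_prod_iff hm).2 ⟨ae_of_all _ fun x => (hσ.integrable_coul_mul x).const_mul (ρ x), ?_⟩
  refine (hσ.abs.integrable_mul_pot hρ.1.abs).congr (ae_of_all _ fun x => ?_)
  simp only [pot, norm_mul, norm_eq_abs, abs_of_nonneg (coul_nonneg _ _), integral_const_mul]

/-- The Coulomb interaction of two charge densities. -/
def interaction (ρ σ : E3 → ℝ) : ℝ := ∫ x, ρ x * pot σ x

lemma interaction_eq_integral_prod {ρ σ : E3 → ℝ} (hρ : Charge ρ) (hσ : Charge σ) :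
    interaction ρ σ = ∫ p : E3 × E3, ρ p.1 * (coul p.1 p.2 * σ p.2) := by
  rw [Measure.volume_eq_prod, integral_prod _ (hρ.integrable_prod hσ)]
  simp only [interaction, pot, integral_const_mul]

lemma interaction_comm {ρ σ : E3 → ℝ} (hρ : Charge ρ) (hσ : Charge σ) :
    interaction ρ σ = interaction σ ρ := by
  rw [interaction_eq_integral_prod hρ hσ, interaction_eq_integral_prod hσ hρ,
    Measure.volume_eq_prod, ← integral_prod_swap]
  refine integral_congr_ae (ae_of_all _ fun p => ?_)
  simp only [Prod.fst_swap, Prod.snd_swap, coul_comm p.2 p.1]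
  ring

lemma pot_congr {ρ σ : E3 → ℝ} (h : ρ =ᵐ[volume] σ) : pot ρ = pot σ := by
  funext x
  refine integral_congr_ae ?_
  filter_upwards [h] with y hy
  rw [hy]

lemma interaction_congr {ρ σ ρ' σ' : E3 → ℝ} (h : ρ =ᵐ[volume] ρ') (h' : σ =ᵐ[volume] σ') :
    interaction ρ σ = interaction ρ' σ' := by
  unfold interaction
  rw [pot_congr h']
  refine integral_congr_ae ?_
  filter_upwards [h] with y hy
  rw [hy]

lemma interaction_const_mul_left (c : ℝ) (ρ σ : E3 → ℝ) :
    interaction (fun y => c * ρ y) σ = c * interaction ρ σ := by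
  unfold interaction
  rw [← integral_const_mul]
  congr 1; funext y; ring

lemma interaction_add_left {ρ ρ' σ : E3 → ℝ} (hρ : Charge ρ) (hρ' : Charge ρ') (hσ : Charge σ) :
    interaction (fun y => ρ y + ρ' y) σ = interaction ρ σ + interaction ρ' σ := by
  unfold interaction
  rw [← integral_add (hσ.integrable_mul_pot hρ.1) (hσ.integrable_mul_pot hρ'.1)]
  simp only [add_mul]

/-- The self-interaction is a quadratic form. -/
lemma interaction_self_add_const_mul {ρ σ : E3 → ℝ} (hρ : Charge ρ) (hσ : Charge σ) (t : ℝ) :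
    interaction (fun x => ρ x + t * σ x) (fun x => ρ x + t * σ x)
      = interaction ρ ρ + 2 * t * interaction ρ σ + t ^ 2 * interaction σ σ := by
  have ht := hσ.const_mul t
  have hs := hρ.add ht
  rw [interaction_add_left hρ ht hs, interaction_const_mul_left, interaction_comm hρ hs,
    interaction_comm hσ hs, interaction_add_left hρ ht hρ, interaction_add_left hρ ht hσ,
    interaction_const_mul_left, interaction_const_mul_left, interaction_comm hσ hρ]
  ring

lemma norm_sq_add_norm_sq_eq (x y z : E3) :
    ‖x - z‖ ^ 2 + ‖y - z‖ ^ 2 = ‖x - y‖ ^ 2 / 2 + 2 * ‖z - (1 / 2 : ℝ) • (x + y)‖ ^ 2 := by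
  have h := parallelogram_law_with_norm ℝ (x - z) (y - z)
  have h1 : x - z + (y - z) = (-2 : ℝ) • (z - (1 / 2 : ℝ) • (x + y)) := by module
  have h2 : x - z - (y - z) = x - y := by abel
  have h3 : ‖(-2 : ℝ)‖ = 2 := by norm_num
  rw [h1, h2, norm_smul, h3] at h
  linarith

lemma integrable_gaussian {t : ℝ} (ht : 0 < t) :
    Integrable (fun z : E3 => rexp (-t * ‖z‖ ^ 2)) := by
  by_contra h
  have h1 := GaussianFourier.integral_rexp_neg_mul_sq_norm (V := E3) ht
  rw [integral_undef h] at h1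
  have : 0 < (π / t) ^ (Module.finrank ℝ E3 / 2 : ℝ) := by positivity
  linarith

/-- Gaussian kernels are positive definite. -/
lemma integral_gaussian_kernel_nonneg {ρ : E3 → ℝ} (hρ : Integrable ρ) {t : ℝ} (ht : 0 < t) :
    0 ≤ ∫ p : E3 × E3, ρ p.1 * ρ p.2 * rexp (-t * ‖p.1 - p.2‖ ^ 2) := by
  set C : ℝ := ∫ z : E3, rexp (-(4 * t) * ‖z‖ ^ 2) with hC
  have hCpos : 0 < C := by
    rw [hC, GaussianFourier.integral_rexp_neg_mul_sq_norm (by positivity)]; positivity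
  have key : ∀ p z : E3 × E3, ∀ z : E3, rexp (-(2 * t) * ‖p.1 - z‖ ^ 2) *
      rexp (-(2 * t) * ‖p.2 - z‖ ^ 2) = rexp (-t * ‖p.1 - p.2‖ ^ 2) *
      rexp (-(4 * t) * ‖z - (1 / 2 : ℝ) • (p.1 + p.2)‖ ^ 2) := by
    intro p _ z
    rw [← Real.exp_add, ← Real.exp_add]
    congr 1
    linear_combination (-(2 * t)) * norm_sq_add_norm_sq_eq p.1 p.2 z
  set F : (E3 × E3) × E3 → ℝ := fun q => ρ q.1.1 * ρ q.1.2 *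
    (rexp (-(2 * t) * ‖q.1.1 - q.2‖ ^ 2) * rexp (-(2 * t) * ‖q.1.2 - q.2‖ ^ 2)) with hF
  have hρρ : Integrable (fun p : E3 × E3 => ρ p.1 * ρ p.2) := hρ.mul_prod hρ
  have hexp : Integrable (fun p : E3 × E3 => ρ p.1 * ρ p.2 * rexp (-t * ‖p.1 - p.2‖ ^ 2)) := by
    refine hρρ.mul_bdd (c := 1) (by fun_prop) (ae_of_all _ fun p => ?_)
    rw [norm_of_nonneg (exp_pos _).le, exp_le_one_iff]
    nlinarith [sq_nonneg ‖p.1 - p.2‖]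
  have hint : ∀ p : E3 × E3, ∫ z, F (p, z) = C * (ρ p.1 * ρ p.2 * rexp (-t * ‖p.1 - p.2‖ ^ 2)) := by
    intro p
    simp only [hF]
    rw [integral_const_mul]
    simp_rw [key p p]
    rw [integral_const_mul,
      integral_sub_right_eq_self (fun z : E3 => rexp (-(4 * t) * ‖z‖ ^ 2))]
    ring
  have hint' : ∀ p : E3 × E3, ∫ z, ‖F (p, z)‖
      = C * ‖ρ p.1 * ρ p.2 * rexp (-t * ‖p.1 - p.2‖ ^ 2)‖ := by
    intro p
    have : ∀ z, ‖F (p, z)‖ = |ρ p.1 * ρ p.2| * (rexp (-t * ‖p.1 - p.2‖ ^ 2) *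
        rexp (-(4 * t) * ‖z - (1 / 2 : ℝ) • (p.1 + p.2)‖ ^ 2)) := by
      intro z
      simp only [hF, norm_mul, norm_eq_abs, abs_mul, Real.abs_exp]
      rw [← key p p z]
    simp_rw [this]
    rw [integral_const_mul, integral_const_mul,
      integral_sub_right_eq_self (fun z : E3 => rexp (-(4 * t) * ‖z‖ ^ 2)), norm_mul,
      norm_eq_abs, norm_eq_abs, Real.abs_exp]
    ring
  have hFi : Integrable F ((volume : Measure (E3 × E3)).prod volume) := by
    have hm : AEStronglyMeasurable F ((volume : Measure (E3 × E3)).prod volume) := by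
      refine hρρ.1.comp_fst.mul ?_
      fun_prop
    refine (integrable_prod_iff hm).2 ⟨ae_of_all _ fun p => ?_, ?_⟩
    · simp only [hF]
      simp_rw [key p p]
      exact (((integrable_gaussian (by positivity)).comp_sub_right _).const_mul _).const_mul _
    · simp_rw [hint']
      exact hexp.norm.const_mul C
  have hswap := integral_integral_swap (f := fun p z => F (p, z)) hFi
  simp_rw [hint] at hswap
  rw [integral_const_mul] at hswap
  have hnn : 0 ≤ ∫ z, ∫ p : E3 × E3, F (p, z) := by
    refine integral_nonneg fun z => ?_
    have : ∫ p : E3 × E3, F (p, z) = (∫ x, ρ x * rexp (-(2 * t) * ‖x - z‖ ^ 2)) *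
        ∫ x, ρ x * rexp (-(2 * t) * ‖x - z‖ ^ 2) := by
      rw [← integral_prod_mul]
      refine integral_congr_ae (ae_of_all _ fun p => ?_)
      simp only [hF]
      ring
    simp only [this]
    exact mul_self_nonneg _
  rw [← hswap] at hnn
  exact nonneg_of_mul_nonneg_right hnn hCpos

lemma integral_rpow_mul_gaussian {z : E3} (hz : z ≠ 0) :
    ∫ t in Ioi (0 : ℝ), t ^ (-1 / 2 : ℝ) * rexp (-t * ‖z‖ ^ 2) = √π * (4 * π) * newt z := by
  have hz' : 0 < ‖z‖ := norm_pos_iff.2 hz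
  have h := integral_rpow_mul_exp_neg_mul_Ioi (a := 1 / 2) (r := ‖z‖ ^ 2) (by norm_num)
    (by positivity)
  have h2 : ((1 / ‖z‖ ^ 2 : ℝ)) ^ (1 / 2 : ℝ) = 1 / ‖z‖ := by
    rw [← sqrt_eq_rpow, sqrt_div zero_le_one, sqrt_one, sqrt_sq hz'.le]
  rw [h2, Gamma_one_half_eq] at h
  unfold newt
  have h3 : √π * (4 * π) * (1 / (4 * π * ‖z‖)) = 1 / ‖z‖ * √π := by
    field_simp
  rw [h3, ← h]
  refine setIntegral_congr_fun measurableSet_Ioi fun t _ => ?_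
  norm_num
  left
  ring

lemma ae_fst_ne_snd : ∀ᵐ p : E3 × E3, p.1 ≠ p.2 := by
  have hm : MeasurableSet {p : E3 × E3 | p.1 ≠ p.2} :=
    (measurableSet_eq_fun measurable_fst measurable_snd).compl
  rw [Measure.volume_eq_prod, Measure.ae_prod_iff_ae_ae hm]
  refine ae_of_all _ fun x => ?_
  have : ∀ᵐ y : E3, y ≠ x := by simp [ae_iff]
  filter_upwards [this] with y hy using hy.symm

/-- The Coulomb kernel is positive semidefinite. -/
lemma interaction_self_nonneg {ρ : E3 → ℝ} (hρ : Charge ρ) : 0 ≤ interaction ρ ρ := by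
  rw [interaction_eq_integral_prod hρ hρ]
  set c : ℝ := √π * (4 * π) with hc
  have hcpos : 0 < c := by positivity
  set F : (E3 × E3) × ℝ → ℝ := fun q => ρ q.1.1 * ρ q.1.2 *
    (q.2 ^ (-1 / 2 : ℝ) * rexp (-q.2 * ‖q.1.1 - q.1.2‖ ^ 2)) with hF
  set ν : Measure ℝ := volume.restrict (Ioi 0) with hν
  have hρρ : Integrable (fun p : E3 × E3 => ρ p.1 * ρ p.2) := hρ.1.mul_prod hρ.1
  have hprod : Integrable (fun p : E3 × E3 => ρ p.1 * (coul p.1 p.2 * ρ p.2)) :=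
    hρ.integrable_prod hρ
  have hint : ∀ᵐ p : E3 × E3, ∫ t, F (p, t) ∂ν = c * (ρ p.1 * (coul p.1 p.2 * ρ p.2)) := by
    filter_upwards [ae_fst_ne_snd] with p hp
    simp only [hF]
    rw [integral_const_mul, integral_rpow_mul_gaussian (sub_ne_zero.2 hp), coul_eq_newt]
    ring
  have hint' : ∀ᵐ p : E3 × E3, ∫ t, ‖F (p, t)‖ ∂ν = c * ‖ρ p.1 * (coul p.1 p.2 * ρ p.2)‖ := by
    filter_upwards [ae_fst_ne_snd] with p hp
    have : ∀ t ∈ Ioi (0 : ℝ), ‖F (p, t)‖ = |ρ p.1 * ρ p.2| *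
        (t ^ (-1 / 2 : ℝ) * rexp (-t * ‖p.1 - p.2‖ ^ 2)) := by
      intro t ht
      simp only [hF]
      rw [norm_mul, norm_eq_abs, norm_of_nonneg]
      exact mul_nonneg (rpow_nonneg (le_of_lt ht) _) (exp_pos _).le
    rw [setIntegral_congr_fun measurableSet_Ioi this, integral_const_mul,
      integral_rpow_mul_gaussian (sub_ne_zero.2 hp), norm_mul, norm_mul,
      norm_of_nonneg (coul_nonneg _ _), coul_eq_newt, abs_mul, norm_eq_abs, norm_eq_abs]
    ring
  have hFi : Integrable F ((volume : Measure (E3 × E3)).prod ν) := by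
    have hm : AEStronglyMeasurable F ((volume : Measure (E3 × E3)).prod ν) := by
      refine hρρ.1.comp_fst.mul ?_
      exact Measurable.aestronglyMeasurable (by fun_prop)
    refine (integrable_prod_iff hm).2 ⟨?_, ?_⟩
    · filter_upwards [ae_fst_ne_snd] with p hp
      simp only [hF]
      refine Integrable.const_mul ?_ _
      by_contra h
      have h1 := integral_rpow_mul_gaussian (sub_ne_zero.2 hp)
      rw [integral_undef h] at h1
      have : 0 < ‖p.1 - p.2‖ := norm_pos_iff.2 (sub_ne_zero.2 hp)
      have : 0 < newt (p.1 - p.2) := by unfold newt; positivity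
      have : 0 < √π * (4 * π) * newt (p.1 - p.2) := by positivity
      linarith
    · exact (hprod.norm.const_mul c).congr (hint'.mono fun p hp => hp.symm)
  have hswap := integral_integral_swap (f := fun p t => F (p, t)) hFi
  rw [integral_congr_ae hint, integral_const_mul] at hswap
  have hnn : 0 ≤ ∫ t, (∫ p : E3 × E3, F (p, t)) ∂ν := by
    refine setIntegral_nonneg measurableSet_Ioi fun t ht => ?_
    have : ∫ p : E3 × E3, F (p, t) = t ^ (-1 / 2 : ℝ) *
        ∫ p : E3 × E3, ρ p.1 * ρ p.2 * rexp (-t * ‖p.1 - p.2‖ ^ 2) := by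
      rw [← integral_const_mul]
      congr 1
      funext p
      simp only [hF]
      ring
    rw [this]
    exact mul_nonneg (rpow_nonneg (le_of_lt ht) _) (integral_gaussian_kernel_nonneg hρ.1 ht)
  rw [← hswap] at hnn
  exact nonneg_of_mul_nonneg_right hnn hcpos

/-- The standard basis vectors of `ℝ³`. -/
def basisVec (i : Fin 3) : E3 := EuclideanSpace.single i 1

lemma norm_sq_add_smul_basisVec (z : E3) (h : ℝ) (i : Fin 3) :
    ‖z + h • basisVec i‖ ^ 2 = ‖z‖ ^ 2 + 2 * h * z i + h ^ 2 := by
  rw [norm_add_sq_real, real_inner_smul_right, norm_smul]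
  simp [basisVec, EuclideanSpace.inner_single_right]
  ring

/-- The discrete Laplacian of the Newtonian kernel. -/
def lapKer (z : E3) : ℝ :=
  ∑ i, (newt (z + basisVec i) + newt (z - basisVec i) - 2 * newt z)

lemma measurable_lapKer : Measurable lapKer := by
  unfold lapKer
  have := measurable_newt
  fun_prop

lemma abs_inv_sqrt_sub_le {ε q : ℝ} (hq : 1 / 2 ≤ q) (hq2 : q ≤ 2) (h : q ^ 2 = 1 + ε) :
    |1 / q - (1 - ε / 2 + 3 / 8 * ε ^ 2)| ≤ 10 * |ε| ^ 3 := by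
  have hε : ε = q ^ 2 - 1 := by linarith
  have hq0 : 0 < q := by linarith
  have e1 : 1 / q - (1 - ε / 2 + 3 / 8 * ε ^ 2) = (q - 1) ^ 3 *
      ((-5 / 2 - 15 / 8 * (q - 1) - 3 / 8 * (q - 1) ^ 2) / q) := by
    rw [hε]; field_simp; ring
  have e2 : |q - 1| ≤ |ε| := by
    rw [hε, show q ^ 2 - 1 = (q - 1) * (q + 1) by ring, abs_mul]
    have : 1 ≤ |q + 1| := by rw [abs_of_pos (by linarith)]; linarith
    nlinarith [abs_nonneg (q - 1)]
  rw [e1, abs_mul, abs_pow, mul_comm]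
  have e3 : |(-5 / 2 - 15 / 8 * (q - 1) - 3 / 8 * (q - 1) ^ 2) / q| ≤ 10 := by
    rw [abs_div, abs_of_pos hq0, div_le_iff₀ hq0, abs_le]
    constructor <;> nlinarith
  gcongr

lemma abs_lapKer_le {z : E3} (hz : 4 ≤ ‖z‖) : |lapKer z| ≤ 2000 * (1 / ‖z‖ ^ 4) := by
  set r := ‖z‖ with hr
  have hr0 : 0 < r := by linarith
  have hcoord : ∀ i, |z i| ≤ r := fun i => by
    have := PiLp.norm_apply_le z i
    simpa using this
  have hs : r ^ 2 = z 0 ^ 2 + z 1 ^ 2 + z 2 ^ 2 := by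
    rw [hr, EuclideanSpace.norm_sq_eq]
    simp [Fin.sum_univ_three]
  have key : ∀ (i : Fin 3) (σ : ℝ), |σ| = 1 →
      |4 * π * r * newt (z + σ • basisVec i) - (1 - (2 * σ * z i + 1) / r ^ 2 / 2
        + 3 / 8 * ((2 * σ * z i + 1) / r ^ 2) ^ 2)| ≤ 270 / r ^ 3 := by
    intro i σ hσ
    have hσ2 : σ ^ 2 = 1 := by rw [← sq_abs, hσ]; norm_num
    have hn := norm_sq_add_smul_basisVec z σ i
    set n := ‖z + σ • basisVec i‖ with hn'
    have hb : ‖σ • basisVec i‖ = 1 := by simp [norm_smul, hσ, basisVec]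
    have hn1 : r - 1 ≤ n := by
      have := norm_sub_le (z + σ • basisVec i) (σ • basisVec i)
      rw [add_sub_cancel_right, hb] at this
      linarith
    have hn2 : n ≤ r + 1 := by
      have := norm_add_le z (σ • basisVec i)
      rw [hb] at this
      linarith
    have hn0 : 0 < n := by linarith
    set ε := (2 * σ * z i + 1) / r ^ 2 with hε
    have habs : |ε| ≤ 3 / r := by
      rw [hε, abs_div, abs_of_pos (by positivity : 0 < r ^ 2), div_le_div_iff₀ (by positivity) hr0]
      have : |2 * σ * z i + 1| ≤ 2 * r + 1 := by
        refine (abs_add_le _ _).trans ?_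
        rw [abs_mul, abs_mul, hσ]
        norm_num
        exact hcoord i
      nlinarith
    have hq := abs_inv_sqrt_sub_le (ε := ε) (q := n / r) (by rw [le_div_iff₀ hr0]; linarith)
      (by rw [div_le_iff₀ hr0]; linarith)
      (by rw [div_pow, hn, hσ2, hε]; field_simp; ring)
    have e1 : 4 * π * r * newt (z + σ • basisVec i) = 1 / (n / r) := by
      unfold newt
      rw [← hn']
      field_simp
    rw [e1]
    refine hq.trans ?_
    calc 10 * |ε| ^ 3 ≤ 10 * (3 / r) ^ 3 := by gcongr
      _ = 270 / r ^ 3 := by field_simp; norm_num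
  have hp : ∀ i, |4 * π * r * newt (z + basisVec i) - (1 - (2 * z i + 1) / r ^ 2 / 2
        + 3 / 8 * ((2 * z i + 1) / r ^ 2) ^ 2)| ≤ 270 / r ^ 3 := fun i => by
    simpa using key i 1 (by norm_num)
  have hm : ∀ i, |4 * π * r * newt (z - basisVec i) - (1 - (2 * -1 * z i + 1) / r ^ 2 / 2
        + 3 / 8 * ((2 * -1 * z i + 1) / r ^ 2) ^ 2)| ≤ 270 / r ^ 3 := fun i => by
    have := key i (-1) (by norm_num)
    rwa [neg_one_smul, ← sub_eq_add_neg] at this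
  have hz0 : 4 * π * r * newt z = 1 := by unfold newt; rw [← hr]; field_simp
  have main : |4 * π * r * lapKer z - 9 / (4 * r ^ 4)| ≤ 6 * (270 / r ^ 3) := by
    have e : 4 * π * r * lapKer z - 9 / (4 * r ^ 4) =
        ∑ i, ((4 * π * r * newt (z + basisVec i) - (1 - (2 * z i + 1) / r ^ 2 / 2
        + 3 / 8 * ((2 * z i + 1) / r ^ 2) ^ 2)) +
        (4 * π * r * newt (z - basisVec i) - (1 - (2 * -1 * z i + 1) / r ^ 2 / 2
        + 3 / 8 * ((2 * -1 * z i + 1) / r ^ 2) ^ 2))) := by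
      have e2 : 9 / (4 * r ^ 4) = -3 / r ^ 2 + 3 / 8 * (8 * r ^ 2 + 6) / r ^ 4 := by
        field_simp; ring
      rw [e2, hs]
      have hs0 : z 0 ^ 2 + z 1 ^ 2 + z 2 ^ 2 ≠ 0 := by rw [← hs]; positivity
      rw [show r ^ 4 = (r ^ 2) ^ 2 by ring, hs]
      simp only [lapKer, Fin.sum_univ_three]
      have e3 : ∀ a b : ℝ, 4 * π * r * (a + b - 2 * newt z) = 4 * π * r * a + 4 * π * r * b - 2 := by
        intro a b; linear_combination (-2) * hz0
      rw [mul_add, mul_add, e3, e3, e3]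
      field_simp
      ring
    rw [e]
    calc _ ≤ ∑ i : Fin 3, (270 / r ^ 3 + 270 / r ^ 3) :=
          (Finset.abs_sum_le_sum_abs _ _).trans (Finset.sum_le_sum fun i _ =>
            (abs_add_le _ _).trans (add_le_add (hp i) (hm i)))
      _ = _ := by simp; ring
  have h4 : |4 * π * r * lapKer z| ≤ 2000 / r ^ 3 := by
    have h5 : 9 / (4 * r ^ 4) ≤ 9 / r ^ 3 := by
      gcongr
      nlinarith [pow_pos hr0 3]
    have h6 : 0 ≤ 9 / (4 * r ^ 4) := by positivity
    have h7 : 6 * (270 / r ^ 3) + 9 / r ^ 3 ≤ 2000 / r ^ 3 := by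
      rw [← mul_div_assoc, ← add_div]; gcongr; norm_num
    rw [abs_le] at main ⊢
    constructor <;> linarith [main.1, main.2]
  rw [abs_mul, abs_of_pos (by positivity)] at h4
  have h8 : r * |lapKer z| ≤ 4 * π * r * |lapKer z| := by
    have : 1 ≤ 4 * π := by linarith [pi_gt_three]
    nlinarith [mul_nonneg hr0.le (abs_nonneg (lapKer z))]
  have h9 : r * |lapKer z| ≤ r * (2000 * (1 / r ^ 4)) := by
    refine (h8.trans h4).trans (le_of_eq ?_)
    field_simp
  exact le_of_mul_le_mul_left h9 hr0

lemma integrableOn_newt_sub (a : E3) (R : ℝ) : IntegrableOn (fun z => newt (z - a)) (ball 0 R) := by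
  have h1 : Integrable ((ball (0 : E3) R).indicator fun _ => (1 : ℝ)) :=
    (integrable_indicator_iff measurableSet_ball).2 (integrableOn_const measure_ball_lt_top.ne)
  have h2 : Charge ((ball (0 : E3) R).indicator fun _ => (1 : ℝ)) :=
    Charge.of_bound h1 (C := 1) (ae_of_all _ fun x => by
      by_cases hx : x ∈ ball (0 : E3) R <;> simp [indicator, hx])
  rw [← integrable_indicator_iff measurableSet_ball]
  refine (h2.integrable_coul_mul a).congr (ae_of_all _ fun z => ?_)
  simp only [coul_comm a z, coul_eq_newt]
  by_cases hx : z ∈ ball (0 : E3) R <;> simp [indicator, hx]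

lemma integrable_lapKer : Integrable lapKer := by
  have h1 : IntegrableOn lapKer (ball 0 4) := by
    unfold lapKer
    refine integrable_finsetSum _ fun i _ => ?_
    have ha := integrableOn_newt_sub (-basisVec i) 4
    simp only [sub_neg_eq_add] at ha
    exact (ha.add (integrableOn_newt_sub (basisVec i) 4)).sub ((integrableOn_newt 4).const_mul 2)
  have h2 : IntegrableOn lapKer (ball 0 4)ᶜ := by
    have hi : Integrable fun z : E3 => 2000 * 16 * (1 + ‖z‖) ^ (-4 : ℝ) :=
      (integrable_one_add_norm (by simp; norm_num)).const_mul _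
    refine hi.integrableOn.mono' measurable_lapKer.aestronglyMeasurable ?_
    filter_upwards [ae_restrict_mem measurableSet_ball.compl] with z hz
    have hz4 : 4 ≤ ‖z‖ := by simpa using hz
    refine (abs_lapKer_le hz4).trans ?_
    rw [rpow_neg (by positivity), show (4 : ℝ) = ((4 : ℕ) : ℝ) by norm_num, rpow_natCast,
      mul_assoc]
    gcongr
    rw [one_div, show (16 : ℝ) = ((1 / 2) ^ 4)⁻¹ by norm_num, ← mul_inv, ← mul_pow]
    gcongr
    linarith
  rw [← integrableOn_univ, ← union_compl_self (ball (0 : E3) 4)]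
  exact h1.union h2

/-- The second differences of a potential at scale `h` are the convolution of the charge density
with a rescaling of `lapKer`. -/
lemma sum_pot_second_difference {ρ : E3 → ℝ} (hρ : Charge ρ) {h : ℝ} (hh : 0 < h) (x : E3) :
    ∑ i, (pot ρ (x + h • basisVec i) + pot ρ (x - h • basisVec i) - 2 * pot ρ x)
      = h ^ 2 * ∫ w, lapKer w * ρ (x - h • w) := by
  have hi : ∀ a : E3, Integrable fun y => newt (a - y) * ρ y := fun a => hρ.integrable_coul_mul a
  have hi2 : ∀ i, Integrable fun y => newt (x + h • basisVec i - y) * ρ y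
      + newt (x - h • basisVec i - y) * ρ y := fun i => (hi _).add (hi _)
  have hi3 : ∀ i, Integrable fun y => newt (x + h • basisVec i - y) * ρ y
      + newt (x - h • basisVec i - y) * ρ y - 2 * (newt (x - y) * ρ y) := fun i =>
    (hi2 i).sub ((hi _).const_mul 2)
  have e1 : ∀ i, pot ρ (x + h • basisVec i) + pot ρ (x - h • basisVec i) - 2 * pot ρ x =
      ∫ y, (newt (x + h • basisVec i - y) * ρ y + newt (x - h • basisVec i - y) * ρ y
        - 2 * (newt (x - y) * ρ y)) := fun i => by
    rw [integral_sub (hi2 i) ((hi _).const_mul 2), integral_add (hi _) (hi _),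
      integral_const_mul]
    rfl
  simp_rw [e1]
  rw [← integral_finsetSum _ fun i _ => hi3 i]
  rw [← integral_sub_left_eq_self _ volume x]
  have h3 := Measure.integral_comp_smul_of_nonneg (volume : Measure E3)
    (fun y => ∑ i, (newt (x + h • basisVec i - (x - y)) * ρ (x - y)
      + newt (x - h • basisVec i - (x - y)) * ρ (x - y) - 2 * (newt (x - (x - y)) * ρ (x - y))))
    h (hR := hh.le)
  have h4 : ∀ F : ℝ, F = h ^ 3 * ((h ^ 3)⁻¹ * F) := fun F => by field_simp
  rw [h4 (∫ _, _)]
  simp only [finrank_euclideanSpace, Fintype.card_fin, smul_eq_mul] at h3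
  rw [← h3, show h ^ 3 = h ^ 2 * h by ring, mul_assoc, ← integral_const_mul]
  congr 2
  funext w
  have e2 : ∀ i, newt (x + h • basisVec i - (x - h • w)) = h⁻¹ * newt (w + basisVec i) := fun i => by
    rw [← newt_smul hh]; congr 1; module
  have e3 : ∀ i, newt (x - h • basisVec i - (x - h • w)) = h⁻¹ * newt (w - basisVec i) := fun i => by
    rw [← newt_smul hh]; congr 1; module
  have e4 : newt (x - (x - h • w)) = h⁻¹ * newt w := by
    rw [← newt_smul hh]; congr 1; module
  simp only [e2, e3, e4, lapKer, Finset.mul_sum, Finset.sum_mul]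
  refine Finset.sum_congr rfl fun i _ => ?_
  field_simp

/-- Translations are continuous in `L¹`. -/
lemma tendsto_lintegral_translate_sub {ρ : E3 → ℝ} (hρ : Integrable ρ) :
    Tendsto (fun a => ∫⁻ x, ‖ρ (x - a) - ρ x‖ₑ) (𝓝 0) (𝓝 0) := by
  have hmem : MemLp ρ 1 := memLp_one_iff_integrable.2 hρ
  set f : Lp ℝ 1 (volume : Measure E3) := hmem.toLp ρ with hf
  let G : E3 → C(E3, E3) := fun a => ⟨fun x => x - a, by fun_prop⟩
  have hG : Continuous G := by
    have : G = (ContinuousMap.curry ⟨fun p : E3 × E3 => p.2 - p.1, by fun_prop⟩ :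
      C(E3, C(E3, E3))) := rfl
    rw [this]
    exact ContinuousMap.continuous _
  have hmp : ∀ a, MeasurePreserving (G a) (volume : Measure E3) volume := fun a =>
    measurePreserving_sub_right volume a
  have hc := Continuous.compMeasurePreservingLp (f := fun _ : E3 => f) continuous_const hG hmp
    (by simp)
  have h0 := hc.tendsto 0
  rw [tendsto_iff_edist_tendsto_0] at h0
  refine h0.congr fun a => ?_
  rw [Lp.edist_def, eLpNorm_one_eq_lintegral_enorm]
  have h1 : ∀ a, (Lp.compMeasurePreserving (G a) (hmp a) f : E3 → ℝ) =ᵐ[volume]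
      fun x => ρ (x - a) := fun a =>
    (Lp.coeFn_compMeasurePreserving f (hmp a)).trans
      ((hmp a).quasiMeasurePreserving.ae_eq_comp hmem.coeFn_toLp)
  refine lintegral_congr_ae ?_
  filter_upwards [h1 a, h1 0] with x hx hx0
  simp only [Pi.sub_apply, hx, hx0, sub_zero]

/-- The total mass of the discrete Laplacian of the Newtonian kernel. -/
def lapMass : ℝ := ∫ w, lapKer w

lemma integrable_lapKer_mul {ρ : E3 → ℝ} (hρ : Measurable ρ) {M : ℝ}
    (hM : ∀ x, |ρ x| ≤ M) (h : ℝ) (x : E3) :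
    Integrable fun w => lapKer w * ρ (x - h • w) :=
  integrable_lapKer.mul_bdd (c := M) (hρ.comp (by fun_prop)).aestronglyMeasurable
    (ae_of_all _ fun _ => hM _)

/-- Discrete Laplacians of potentials converge in `L¹` to a multiple of the charge density. -/
lemma tendsto_lintegral_discreteLaplacian_sub {ρ : E3 → ℝ} (hρ : Integrable ρ) (hρm : Measurable ρ)
    {M : ℝ} (hM : ∀ x, |ρ x| ≤ M) :
    Tendsto (fun h : ℝ => ∫⁻ x, ‖(∫ w, lapKer w * ρ (x - h • w)) - lapMass * ρ x‖ₑ)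
      (𝓝[>] 0) (𝓝 0) := by
  have hτ := tendsto_lintegral_translate_sub hρ
  have hdom : Tendsto (fun h : ℝ => ∫⁻ w, ‖lapKer w‖ₑ * ∫⁻ x, ‖ρ (x - h • w) - ρ x‖ₑ)
      (𝓝[>] 0) (𝓝 (∫⁻ w : E3, 0)) := by
    have hae : ∀ h : ℝ, Measurable (fun p : E3 × E3 => ‖ρ (p.2 - h • p.1) - ρ p.2‖ₑ) := by
      fun_prop
    refine tendsto_lintegral_filter_of_dominated_convergence
      (fun w => ‖lapKer w‖ₑ * (2 * ∫⁻ x, ‖ρ x‖ₑ)) ?_ ?_ ?_ ?_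
    · exact Eventually.of_forall fun h =>
        measurable_lapKer.enorm.mul (hae h).lintegral_prod_right'
    · refine Eventually.of_forall fun h => ae_of_all _ fun w => ?_
      gcongr
      calc ∫⁻ x, ‖ρ (x - h • w) - ρ x‖ₑ ≤ ∫⁻ x, (‖ρ (x - h • w)‖ₑ + ‖ρ x‖ₑ) :=
            lintegral_mono fun x => enorm_sub_le
        _ = (∫⁻ x, ‖ρ (x - h • w)‖ₑ) + ∫⁻ x, ‖ρ x‖ₑ := lintegral_add_right _ hρm.enorm
        _ = 2 * ∫⁻ x, ‖ρ x‖ₑ := by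
            rw [two_mul, lintegral_sub_right_eq_self (fun x => ‖ρ x‖ₑ) (h • w)]
    · rw [lintegral_mul_const _ measurable_lapKer.enorm]
      exact ENNReal.mul_ne_top integrable_lapKer.2.ne
        (ENNReal.mul_ne_top (by simp) hρ.2.ne)
    · refine ae_of_all _ fun w => ?_
      have h1 : Tendsto (fun h : ℝ => h • w) (𝓝[>] 0) (𝓝 0) := by
        have : Tendsto (fun h : ℝ => h • w) (𝓝 0) (𝓝 ((0 : ℝ) • w)) :=
          (continuous_id.smul continuous_const).tendsto 0
        rw [zero_smul] at this
        exact this.mono_left nhdsWithin_le_nhds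
      have h2 := ENNReal.Tendsto.const_mul (hτ.comp h1) (a := ‖lapKer w‖ₑ)
        (Or.inr enorm_ne_top)
      simpa using h2
  simp only [lintegral_zero] at hdom
  refine tendsto_of_tendsto_of_tendsto_of_le_of_le' tendsto_const_nhds hdom
    (Eventually.of_forall fun _ => zero_le) ?_
  filter_upwards [self_mem_nhdsWithin] with h hh
  have hh : 0 < h := hh
  have h1 : ∀ x, ‖(∫ w, lapKer w * ρ (x - h • w)) - lapMass * ρ x‖ₑ ≤
      ∫⁻ w, ‖lapKer w‖ₑ * ‖ρ (x - h • w) - ρ x‖ₑ := by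
    intro x
    rw [lapMass, ← integral_mul_const, ← integral_sub (integrable_lapKer_mul hρm hM h x)
      (integrable_lapKer.mul_const _)]
    refine (enorm_integral_le_lintegral_enorm _).trans (le_of_eq ?_)
    simp only [← mul_sub, enorm_mul]
  refine (lintegral_mono h1).trans (le_of_eq ?_)
  rw [lintegral_lintegral_swap]
  · refine lintegral_congr fun w => ?_
    rw [lintegral_const_mul' _ _ enorm_ne_top]
  · exact Measurable.aemeasurable (by
      have := measurable_lapKer
      fun_prop)

/-- On a set where its potential is constant, a bounded charge density vanishes,
provided `lapMass` is nonzero. -/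
lemma ae_eq_zero_of_pot_const (hc : lapMass ≠ 0) {ρ : E3 → ℝ} (hρ : Integrable ρ) (hρm : Measurable ρ)
    {M : ℝ} (hM : ∀ x, |ρ x| ≤ M) {S : Set E3} (hS : MeasurableSet S) (hS' : volume S ≠ ⊤) {κ : ℝ}
    (hκ : ∀ x ∈ S, pot ρ x = κ) : ∀ᵐ x, x ∈ S → ρ x = 0 := by
  have hρc : Charge ρ := Charge.of_bound hρ (ae_of_all _ hM)
  set χ : E3 → ℝ := S.indicator fun _ => 1 with hχ
  have hχi : Integrable χ := (integrable_indicator_iff hS).2 (integrableOn_const hS')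
  have hτ := tendsto_lintegral_translate_sub hχi
  have hshift : ∀ v : E3, Tendsto (fun h : ℝ => ∫⁻ x, ‖χ (x - h • v) - χ x‖ₑ) (𝓝[>] 0) (𝓝 0) := by
    intro v
    have : Tendsto (fun h : ℝ => h • v) (𝓝 0) (𝓝 ((0 : ℝ) • v)) :=
      (continuous_id.smul continuous_const).tendsto 0
    rw [zero_smul] at this
    exact hτ.comp (this.mono_left nhdsWithin_le_nhds)
  set B : ℝ → ENNReal := fun h =>
    (∫⁻ x, ‖(∫ w, lapKer w * ρ (x - h • w)) - lapMass * ρ x‖ₑ) +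
      ‖lapMass * M‖ₑ * ∑ i, ((∫⁻ x, ‖χ (x - h • basisVec i) - χ x‖ₑ) +
        ∫⁻ x, ‖χ (x - h • -basisVec i) - χ x‖ₑ) with hB
  have hBlim : Tendsto B (𝓝[>] 0) (𝓝 0) := by
    have h1 := ENNReal.Tendsto.const_mul (a := ‖lapMass * M‖ₑ)
      (tendsto_finsetSum (s := Finset.univ) (f := fun i h =>
        (∫⁻ x, ‖χ (x - h • basisVec i) - χ x‖ₑ) + ∫⁻ x, ‖χ (x - h • -basisVec i) - χ x‖ₑ)
        fun i _ => (hshift (basisVec i)).add (hshift (-basisVec i))) (Or.inr enorm_ne_top)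
    have h2 := (tendsto_lintegral_discreteLaplacian_sub hρ hρm hM).add h1
    simp only [Finset.sum_const_zero, add_zero, mul_zero] at h2
    exact h2
  have hle : ∀ h ∈ Ioi (0 : ℝ), ∫⁻ x in S, ‖lapMass * ρ x‖ₑ ≤ B h := by
    intro h hh
    have hh : 0 < h := hh
    have hmeas : ∀ v : E3, AEMeasurable fun x => ‖χ (x - h • v) - χ x‖ₑ := fun v =>
      ((hχi.comp_sub_right _).sub hχi).1.enorm
    have hmeas2 : ∀ i, AEMeasurable fun x => ‖χ (x - h • basisVec i) - χ x‖ₑ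
        + ‖χ (x - h • -basisVec i) - χ x‖ₑ := fun i => (hmeas _).add (hmeas _)
    have hpt : ∀ᵐ x, x ∈ S → ‖lapMass * ρ x‖ₑ ≤
        ‖lapMass * M‖ₑ * ∑ i, (‖χ (x - h • basisVec i) - χ x‖ₑ + ‖χ (x - h • -basisVec i) - χ x‖ₑ)
          + ‖(∫ w, lapKer w * ρ (x - h • w)) - lapMass * ρ x‖ₑ := by
      refine ae_of_all _ fun x hxS => ?_
      by_cases hall : ∀ i, x - h • basisVec i ∈ S ∧ x - h • -basisVec i ∈ S
      · have h0 := sum_pot_second_difference hρc hh x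
        have h1 : ∑ i, (pot ρ (x + h • basisVec i) + pot ρ (x - h • basisVec i) - 2 * pot ρ x)
            = 0 := by
          refine Finset.sum_eq_zero fun i _ => ?_
          have h2 := (hall i).2
          rw [smul_neg, sub_neg_eq_add] at h2
          rw [hκ _ h2, hκ _ (hall i).1, hκ _ hxS]
          ring
        rw [h1] at h0
        have h3 : ∫ w, lapKer w * ρ (x - h • w) = 0 := by
          have : h ^ 2 ≠ 0 := by positivity
          exact (mul_eq_zero.1 h0.symm).resolve_left this
        rw [h3, zero_sub, enorm_neg]
        exact le_add_self
      · push Not at hall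
        obtain ⟨i, hi⟩ := hall
        have h1 : (1 : ENNReal) ≤ ‖χ (x - h • basisVec i) - χ x‖ₑ
            + ‖χ (x - h • -basisVec i) - χ x‖ₑ := by
          by_cases hp : x - h • basisVec i ∈ S
          · have : ‖χ (x - h • -basisVec i) - χ x‖ₑ = 1 := by
              simp only [hχ, indicator_of_notMem (hi hp), indicator_of_mem hxS]
              simp
            rw [this]
            exact le_add_self
          · have : ‖χ (x - h • basisVec i) - χ x‖ₑ = 1 := by
              simp only [hχ, indicator_of_notMem hp, indicator_of_mem hxS]
              simp
            rw [this]
            exact le_self_add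
        have h2 : (1 : ENNReal) ≤ ∑ i, (‖χ (x - h • basisVec i) - χ x‖ₑ
            + ‖χ (x - h • -basisVec i) - χ x‖ₑ) :=
          h1.trans (Finset.single_le_sum (f := fun i => ‖χ (x - h • basisVec i) - χ x‖ₑ
            + ‖χ (x - h • -basisVec i) - χ x‖ₑ) (fun _ _ => zero_le) (Finset.mem_univ i))
        calc ‖lapMass * ρ x‖ₑ ≤ ‖lapMass * M‖ₑ := by
              rw [enorm_mul, enorm_mul]
              gcongr
              rw [enorm_le_iff_norm_le, norm_eq_abs]
              exact (hM x).trans (le_abs_self M)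
          _ ≤ ‖lapMass * M‖ₑ * ∑ i, (‖χ (x - h • basisVec i) - χ x‖ₑ
              + ‖χ (x - h • -basisVec i) - χ x‖ₑ) := le_mul_of_one_le_right zero_le h2
          _ ≤ _ := le_self_add
    calc ∫⁻ x in S, ‖lapMass * ρ x‖ₑ
        ≤ ∫⁻ x in S, (‖lapMass * M‖ₑ * ∑ i, (‖χ (x - h • basisVec i) - χ x‖ₑ
          + ‖χ (x - h • -basisVec i) - χ x‖ₑ)
          + ‖(∫ w, lapKer w * ρ (x - h • w)) - lapMass * ρ x‖ₑ) :=
          setLIntegral_mono_ae' hS hpt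
      _ ≤ ∫⁻ x, (‖lapMass * M‖ₑ * ∑ i, (‖χ (x - h • basisVec i) - χ x‖ₑ
          + ‖χ (x - h • -basisVec i) - χ x‖ₑ)
          + ‖(∫ w, lapKer w * ρ (x - h • w)) - lapMass * ρ x‖ₑ) := setLIntegral_le_lintegral _ _
      _ = B h := by
          rw [lintegral_add_left' ((Finset.aemeasurable_fun_sum _ fun i _ =>
            hmeas2 i).const_mul _), lintegral_const_mul' _ _ enorm_ne_top,
            lintegral_finsetSum' _ fun i _ => hmeas2 i, add_comm]
          simp only [hB]
          congr 3
          funext i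
          exact lintegral_add_left' (hmeas _) _
  have hzero : ∫⁻ x in S, ‖lapMass * ρ x‖ₑ = 0 :=
    le_antisymm (ge_of_tendsto hBlim (eventually_mem_nhdsWithin.mono hle)) zero_le
  rw [lintegral_eq_zero_iff' (hρ.1.const_mul _).enorm.restrict] at hzero
  have := (ae_restrict_iff' hS).1 hzero
  filter_upwards [this] with x hx hxS
  simpa [hc] using hx hxS

/-- The tent function supported in the unit ball. -/
def tent (x : E3) : ℝ := max 0 (1 - ‖x‖)

lemma continuous_tent : Continuous tent := by unfold tent; fun_prop

lemma tent_nonneg (x : E3) : 0 ≤ tent x := le_max_left _ _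

lemma tent_le_one (x : E3) : tent x ≤ 1 := by
  unfold tent
  exact max_le zero_le_one (by linarith [norm_nonneg x])

lemma abs_tent_le_one (x : E3) : |tent x| ≤ 1 := by
  rw [abs_of_nonneg (tent_nonneg x)]; exact tent_le_one x

lemma tent_eq_zero {x : E3} (hx : 1 ≤ ‖x‖) : tent x = 0 := max_eq_left (by linarith)

lemma tent_pos {x : E3} (hx : ‖x‖ < 1) : 0 < tent x := lt_max_of_lt_right (by linarith)

lemma hasCompactSupport_tent : HasCompactSupport tent :=
  HasCompactSupport.intro (isCompact_closedBall 0 1) fun x hx => by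
    rw [mem_closedBall_zero_iff, not_le] at hx
    exact tent_eq_zero hx.le

lemma integrable_tent : Integrable tent :=
  continuous_tent.integrable_of_hasCompactSupport hasCompactSupport_tent

lemma charge_tent : Charge tent := Charge.of_bound integrable_tent (ae_of_all _ abs_tent_le_one)

lemma locallyIntegrable_newt : LocallyIntegrable newt := by
  intro x
  refine ⟨ball 0 (‖x‖ + 1), isOpen_ball.mem_nhds (by simp), integrableOn_newt _⟩

lemma continuous_pot_tent : Continuous (pot tent) := by
  have h := hasCompactSupport_tent.continuous_convolution_left (ContinuousLinearMap.mul ℝ ℝ)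
    continuous_tent locallyIntegrable_newt (μ := volume)
  convert h using 1
  funext x
  simp only [pot, convolution, ContinuousLinearMap.mul_apply', coul_eq_newt, mul_comm]

lemma pot_tent_zero_pos : 0 < pot tent 0 := by
  unfold pot
  rw [integral_pos_iff_support_of_nonneg
    (fun y => mul_nonneg (coul_nonneg 0 y) (tent_nonneg y)) (charge_tent.integrable_coul_mul 0)]
  have ho : IsOpen (ball (0 : E3) 1 \ {0}) := isOpen_ball.sdiff isClosed_singleton
  refine (ho.measure_pos volume ⟨(1 / 2 : ℝ) • basisVec 0, ?_⟩).trans_le (measure_mono ?_)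
  · have hb : ‖basisVec 0‖ = 1 := by simp [basisVec]
    refine ⟨?_, ?_⟩
    · rw [mem_ball_zero_iff, norm_smul, hb]; norm_num
    · rw [mem_singleton_iff, ← norm_eq_zero, norm_smul, hb]; norm_num
  · rintro y ⟨hy1, hy0⟩
    rw [mem_ball_zero_iff] at hy1
    have h1 := tent_pos hy1
    have h2 : 0 < ‖y‖ := norm_pos_iff.2 hy0
    refine (mul_pos ?_ h1).ne'
    rw [coul, zero_sub, norm_neg]
    positivity

lemma pot_tent_le {x : E3} (hx : 1 < ‖x‖) :
    pot tent x ≤ 1 / (4 * π * (‖x‖ - 1)) * ∫ y, tent y := by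
  unfold pot
  rw [← integral_const_mul]
  refine integral_mono (charge_tent.integrable_coul_mul x) (integrable_tent.const_mul _) fun y => ?_
  by_cases hy : 1 ≤ ‖y‖
  · simp [tent_eq_zero hy]
  · refine mul_le_mul_of_nonneg_right ?_ (tent_nonneg y)
    refine newt_le (by linarith) ?_
    linarith [norm_sub_norm_le x y]

lemma lapMass_ne_zero : lapMass ≠ 0 := by
  set G := ∫ y, tent y with hG
  have hG0 : 0 ≤ G := integral_nonneg tent_nonneg
  set P := pot tent 0 with hP
  have hP0 : 0 < P := pot_tent_zero_pos
  set R := 2 + G / P with hR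
  have hGP : 0 ≤ G / P := by positivity
  set ε := P / (4 * R ^ 2) with hε
  have hR0 : 0 < R := by linarith
  have hε0 : 0 < ε := by positivity
  obtain ⟨x, hxR, hmax⟩ := (isCompact_closedBall (0 : E3) R).exists_isMaxOn
    (nonempty_closedBall.2 hR0.le) (f := fun x => pot tent x + ε * ‖x‖ ^ 2)
    (continuous_pot_tent.add (by fun_prop)).continuousOn
  have hlt : ‖x‖ < R := by
    refine lt_of_le_of_ne (mem_closedBall_zero_iff.1 hxR) fun heq => ?_
    have h0 : pot tent 0 + ε * ‖(0 : E3)‖ ^ 2 ≤ pot tent x + ε * ‖x‖ ^ 2 :=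
      hmax (mem_closedBall_self hR0.le)
    have h1 := pot_tent_le (x := x) (by linarith)
    rw [heq] at h0 h1
    have h2 : ε * R ^ 2 = P / 4 := by rw [hε]; field_simp
    have h3 : 1 / (4 * π * (R - 1)) * G ≤ P / 4 := by
      have h4 : (0 : ℝ) < R - 1 := by linarith
      have h5 : G ≤ P * (R - 1) := by
        rw [hR]; field_simp; nlinarith
      rw [one_div, inv_mul_le_iff₀ (by positivity)]
      have := pi_gt_three
      have h6 : 0 ≤ P * (R - 1) := by positivity
      nlinarith
    rw [norm_zero, h2] at h0
    nlinarith
  have hlim : Tendsto (fun h : ℝ => ∫ w, lapKer w * tent (x - h • w)) (𝓝[>] 0)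
      (𝓝 (∫ w, lapKer w * tent x)) := by
    refine tendsto_integral_filter_of_dominated_convergence (fun w => |lapKer w|) ?_ ?_ ?_ ?_
    · exact Eventually.of_forall fun h =>
        (integrable_lapKer_mul continuous_tent.measurable abs_tent_le_one h x).1
    · refine Eventually.of_forall fun h => ae_of_all _ fun w => ?_
      rw [norm_mul, norm_eq_abs, norm_eq_abs]
      exact mul_le_of_le_one_right (abs_nonneg _) (abs_tent_le_one _)
    · exact integrable_lapKer.abs
    · refine ae_of_all _ fun w => ?_
      have : Continuous fun h : ℝ => lapKer w * tent (x - h • w) := by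
        have := continuous_tent
        fun_prop
      have := this.tendsto 0
      rw [zero_smul, sub_zero] at this
      exact this.mono_left nhdsWithin_le_nhds
  have hev : ∀ᶠ h : ℝ in 𝓝[>] 0, ∫ w, lapKer w * tent (x - h • w) ≤ -(6 * ε) := by
    have h1 : Ioo (0 : ℝ) (R - ‖x‖) ∈ 𝓝[>] 0 := Ioo_mem_nhdsGT (by linarith)
    filter_upwards [h1] with h hh
    have hmem : ∀ i, ∀ s : ℝ, |s| = h → x + s • basisVec i ∈ closedBall (0 : E3) R := by
      intro i s hs
      rw [mem_closedBall_zero_iff]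
      have h2 := norm_add_le x (s • basisVec i)
      have h3 : ‖s • basisVec i‖ = h := by simp [norm_smul, basisVec, hs]
      linarith [hh.2]
    have hsum := sum_pot_second_difference charge_tent hh.1 x
    have hterm : ∀ i, pot tent (x + h • basisVec i) + pot tent (x - h • basisVec i)
        - 2 * pot tent x ≤ -(2 * ε * h ^ 2) := by
      intro i
      have h2 : pot tent (x + h • basisVec i) + ε * ‖x + h • basisVec i‖ ^ 2
        ≤ pot tent x + ε * ‖x‖ ^ 2 := hmax (hmem i h (abs_of_pos hh.1))
      have h3 : pot tent (x + (-h) • basisVec i) + ε * ‖x + (-h) • basisVec i‖ ^ 2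
        ≤ pot tent x + ε * ‖x‖ ^ 2 := hmax (hmem i (-h) (by rw [abs_neg, abs_of_pos hh.1]))
      rw [norm_sq_add_smul_basisVec] at h2 h3
      rw [neg_smul, ← sub_eq_add_neg] at h3
      nlinarith
    have h4 := Finset.sum_le_sum fun i (_ : i ∈ Finset.univ) => hterm i
    rw [hsum, Finset.sum_const, Finset.card_univ, Fintype.card_fin, nsmul_eq_mul] at h4
    have h5 : 0 < h ^ 2 := by have := hh.1; positivity
    push_cast at h4
    nlinarith
  have hfin := le_of_tendsto hlim hev
  rw [integral_mul_const] at hfin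
  intro h0
  rw [lapMass] at h0
  rw [h0, zero_mul] at hfin
  linarith

/-- The Cauchy–Schwarz inequality for the degenerate case of the interaction form. -/
lemma interaction_eq_zero_of_self_eq_zero {ρ σ : E3 → ℝ} (hρ : Charge ρ) (hσ : Charge σ)
    (h : interaction ρ ρ = 0) : interaction ρ σ = 0 := by
  by_contra hne
  have hq : ∀ t : ℝ, 0 ≤ 2 * t * interaction σ ρ + interaction σ σ := by
    intro t
    have h1 := interaction_self_add_const_mul hσ hρ t
    rw [h] at h1
    have h2 := interaction_self_nonneg (hσ.add (hρ.const_mul t))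
    linarith
  rw [interaction_comm hρ hσ] at hne
  have := hq (-(interaction σ σ + 1) / (2 * interaction σ ρ))
  have h3 : 2 * (-(interaction σ σ + 1) / (2 * interaction σ ρ)) * interaction σ ρ
    = -(interaction σ σ + 1) := by field_simp
  rw [h3] at this
  linarith

/-- The Coulomb self-interaction is definite on bounded integrable charge densities. -/
lemma ae_eq_zero_of_interaction_self_eq_zero {ρ : E3 → ℝ} (hρ : Integrable ρ) (hρm : Measurable ρ)
    {M : ℝ} (hM : ∀ x, |ρ x| ≤ M) (h : interaction ρ ρ = 0) : ρ =ᵐ[volume] 0 := by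
  have hc : Charge ρ := Charge.of_bound hρ (ae_of_all _ hM)
  obtain ⟨C, hC0, hC⟩ := hc.exists_pot_bound
  have hball : ∀ n : ℕ, ∀ᵐ x, x ∈ ball (0 : E3) n → ρ x = 0 := by
    intro n
    set σ : E3 → ℝ := (ball (0 : E3) n).indicator (pot ρ) with hσ
    have hσm : Measurable σ := (measurable_pot hρm).indicator measurableSet_ball
    have hσb : ∀ x, |σ x| ≤ C := fun x => by
      by_cases hx : x ∈ ball (0 : E3) n
      · rw [hσ, indicator_of_mem hx]; exact (abs_pot_le ρ x).trans (hC x)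
      · rw [hσ, indicator_of_notMem hx, abs_zero]; exact hC0
    have hσi : Integrable σ := by
      rw [hσ, integrable_indicator_iff measurableSet_ball]
      refine (integrableOn_const (C := C) measure_ball_lt_top.ne).mono'
        (measurable_pot hρm).aestronglyMeasurable (ae_of_all _ fun x => ?_)
      exact (abs_pot_le ρ x).trans (hC x)
    have hσc : Charge σ := Charge.of_bound hσi (ae_of_all _ hσb)
    have h1 := interaction_eq_zero_of_self_eq_zero hc hσc h
    rw [interaction_comm hc hσc, interaction, integral_eq_zero_iff_of_nonneg ?_
      (hc.integrable_mul_pot hσi)] at h1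
    · have h2 := ae_eq_zero_of_pot_const lapMass_ne_zero hρ hρm hM
        (S := ball 0 n ∩ pot ρ ⁻¹' {0})
        (measurableSet_ball.inter (measurable_pot hρm (measurableSet_singleton 0)))
        ((measure_mono inter_subset_left).trans_lt measure_ball_lt_top).ne (κ := 0)
        fun x hx => hx.2
      filter_upwards [h1, h2] with x hx1 hx2 hx
      refine hx2 ⟨hx, ?_⟩
      simp only [hσ, indicator_of_mem hx, Pi.zero_apply, mul_self_eq_zero] at hx1
      exact hx1
    · intro x
      by_cases hx : x ∈ ball (0 : E3) n
      · simp only [hσ, indicator_of_mem hx, Pi.zero_apply]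
        exact mul_self_nonneg _
      · simp [hσ, indicator_of_notMem hx]
  filter_upwards [ae_all_iff.2 hball] with x hx
  obtain ⟨n, hn⟩ := exists_nat_gt ‖x‖
  exact hx n (mem_ball_zero_iff.2 hn)

/-- In a real Hilbert space, a convex continuous function that is bounded below attains its
minimum on a nonempty closed bounded convex set. -/
lemma ConvexOn.exists_isMinOn_of_isClosed_of_bounded {H : Type*} [NormedAddCommGroup H]
    [InnerProductSpace ℝ H] [CompleteSpace H] {K : Set H} (hne : K.Nonempty) (hcl : IsClosed K)
    {C : ℝ} (hbd : ∀ x ∈ K, ‖x‖ ≤ C) {F : H → ℝ} (hF : ConvexOn ℝ K F)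
    (hcont : ContinuousOn F K) (hbelow : BddBelow (F '' K)) :
    ∃ x ∈ K, ∀ y ∈ K, F x ≤ F y := by
  set m := sInf (F '' K) with hm
  have hmle : ∀ y ∈ K, m ≤ F y := fun y hy => csInf_le hbelow (mem_image_of_mem F hy)
  set A : ℕ → Set H := fun n => {x | x ∈ K ∧ F x ≤ m + 1 / ((n : ℝ) + 1)} with hA
  have hAne : ∀ n, (A n).Nonempty := by
    intro n
    have : m < m + 1 / ((n : ℝ) + 1) := by
      have : (0 : ℝ) < 1 / ((n : ℝ) + 1) := by positivity
      linarith
    obtain ⟨_, ⟨x, hx, rfl⟩, hlt⟩ := exists_lt_of_csInf_lt (hne.image F) this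
    exact ⟨x, hx, hlt.le⟩
  have hAcl : ∀ n, IsClosed (A n) := fun n =>
    hcont.preimage_isClosed_of_isClosed hcl isClosed_Iic
  have hAconv : ∀ n, Convex ℝ (A n) := fun n => hF.convex_le _
  have hmono : ∀ n k, n ≤ k → A k ⊆ A n := by
    intro n k hnk x hx
    refine ⟨hx.1, hx.2.trans ?_⟩
    gcongr
  have hex : ∀ n, ∃ v ∈ A n, ∀ w ∈ A n, ‖v‖ ≤ ‖w‖ := by
    intro n
    obtain ⟨v, hv, hv2⟩ := exists_norm_eq_iInf_of_complete_convex (hAne n) (hAcl n).isComplete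
      (hAconv n) 0
    refine ⟨v, hv, fun w hw => ?_⟩
    simp only [zero_sub, norm_neg] at hv2
    rw [hv2]
    exact ciInf_le (f := fun w : A n => ‖(w : H)‖)
      ⟨0, by rintro _ ⟨w, rfl⟩; exact norm_nonneg _⟩ ⟨w, hw⟩
  choose x hxA hxmin using hex
  have hxmono : Monotone fun n => ‖x n‖ := fun n k hnk => hxmin n _ (hmono n k hnk (hxA k))
  have hxb : BddAbove (range fun n => ‖x n‖) :=
    ⟨C, by rintro _ ⟨n, rfl⟩; exact hbd _ (hxA n).1⟩
  set L := ⨆ n, ‖x n‖ with hL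
  have hlim : Tendsto (fun n => ‖x n‖) atTop (𝓝 L) := tendsto_atTop_ciSup hxmono hxb
  have hleL : ∀ n, ‖x n‖ ≤ L := fun n => le_ciSup hxb n
  have key : ∀ n k, n ≤ k → ‖x n - x k‖ ^ 2 ≤ 2 * (‖x k‖ ^ 2 - ‖x n‖ ^ 2) := by
    intro n k hnk
    have h1 := parallelogram_law_with_norm ℝ (x n) (x k)
    have h2 : (1 / 2 : ℝ) • x n + (1 / 2 : ℝ) • x k ∈ A n :=
      hAconv n (hxA n) (hmono n k hnk (hxA k)) (by norm_num) (by norm_num) (by norm_num)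
    have h3 := hxmin n _ h2
    rw [← smul_add, norm_smul] at h3
    norm_num at h3
    have h4 := norm_nonneg (x n)
    nlinarith
  have hcauchy : CauchySeq x := by
    refine cauchySeq_of_le_tendsto_0 (fun N => √(2 * (L ^ 2 - ‖x N‖ ^ 2))) ?_ ?_
    · have main : ∀ n k N, N ≤ n → n ≤ k →
          dist (x n) (x k) ≤ √(2 * (L ^ 2 - ‖x N‖ ^ 2)) := by
        intro n k N hN hnk
        rw [dist_eq_norm]
        refine Real.le_sqrt_of_sq_le ((key n k hnk).trans ?_)
        have h1 := hleL k
        have h2 := hxmono hN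
        have h3 := norm_nonneg (x k)
        have h4 := norm_nonneg (x N)
        simp only at h2
        nlinarith
      intro n k N hn hk
      rcases le_total n k with h | h
      · exact main n k N hn h
      · rw [dist_comm]; exact main k n N hk h
    · have h1 : Tendsto (fun N => √(2 * (L ^ 2 - ‖x N‖ ^ 2))) atTop
          (𝓝 (√(2 * (L ^ 2 - L ^ 2)))) :=
        (((tendsto_const_nhds.sub (hlim.pow 2)).const_mul 2).sqrt)
      simpa using h1
  obtain ⟨z, hz⟩ := cauchySeq_tendsto_of_complete hcauchy
  have hzA : ∀ n, z ∈ A n := fun n => (hAcl n).mem_of_tendsto hz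
    (eventually_atTop.2 ⟨n, fun k hk => hmono n k hk (hxA k)⟩)
  refine ⟨z, (hzA 0).1, fun y hy => ?_⟩
  have h1 : Tendsto (fun n : ℕ => m + 1 / ((n : ℝ) + 1)) atTop (𝓝 (m + 0)) :=
    tendsto_const_nhds.add tendsto_one_div_add_atTop_nhds_zero_nat
  rw [add_zero] at h1
  exact (ge_of_tendsto' h1 fun n => (hzA n).2).trans (hmle y hy)

lemma interaction_self_convex_comb {ρ σ : E3 → ℝ} (hρ : Charge ρ) (hσ : Charge σ) (t : ℝ) :
    interaction (fun x => σ x + t * (ρ x - σ x)) (fun x => σ x + t * (ρ x - σ x))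
      = (1 - t) * interaction σ σ + t * interaction ρ ρ
        - t * (1 - t) * interaction (fun x => ρ x - σ x) (fun x => ρ x - σ x) := by
  have h1 := interaction_self_add_const_mul hσ (hρ.sub hσ) t
  have h2 := interaction_self_add_const_mul hσ (hρ.sub hσ) 1
  simp only [one_mul, add_sub_cancel] at h2
  rw [h1, h2]
  ring

/-- The admissible densities of the relaxed problem. -/
structure AdmR (Ωp : Set E3) (lam : ℝ) (v : E3 → ℝ) : Prop where
  integrable : Integrable v
  nonneg : ∀ᵐ x, 0 ≤ v x
  le_one : ∀ᵐ x, v x ≤ 1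
  eq_zero : ∀ᵐ x, x ∈ Ωp → v x = 0
  integral_le : ∫ x, v x ≤ lam

namespace AdmR

variable {Ωp : Set E3} {lam : ℝ} {u v : E3 → ℝ}

lemma abs_le_one (hv : AdmR Ωp lam v) : ∀ᵐ x, |v x| ≤ 1 := by
  filter_upwards [hv.nonneg, hv.le_one] with x h0 h1
  rwa [abs_of_nonneg h0]

lemma charge (hv : AdmR Ωp lam v) : Charge v := Charge.of_bound hv.integrable hv.abs_le_one

lemma integral_abs_le (hv : AdmR Ωp lam v) : ∫ x, |v x| ≤ lam := by
  refine le_trans (le_of_eq (integral_congr_ae ?_)) hv.integral_le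
  filter_upwards [hv.nonneg] with x h0
  exact abs_of_nonneg h0

lemma congr (hv : AdmR Ωp lam v) (h : v =ᵐ[volume] u) : AdmR Ωp lam u where
  integrable := hv.integrable.congr h
  nonneg := by filter_upwards [hv.nonneg, h] with x h1 h2; rwa [← h2]
  le_one := by filter_upwards [hv.le_one, h] with x h1 h2; rwa [← h2]
  eq_zero := by filter_upwards [hv.eq_zero, h] with x h1 h2; rwa [← h2]
  integral_le := by rw [← integral_congr_ae h]; exact hv.integral_le

lemma convex_comb (hu : AdmR Ωp lam u) (hv : AdmR Ωp lam v) {a b : ℝ} (ha : 0 ≤ a) (hb : 0 ≤ b)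
    (hab : a + b = 1) : AdmR Ωp lam fun x => a * u x + b * v x where
  integrable := (hu.integrable.const_mul a).add (hv.integrable.const_mul b)
  nonneg := by
    filter_upwards [hu.nonneg, hv.nonneg] with x h1 h2
    positivity
  le_one := by
    filter_upwards [hu.le_one, hv.le_one] with x h1 h2
    nlinarith
  eq_zero := by
    filter_upwards [hu.eq_zero, hv.eq_zero] with x h1 h2 hx
    rw [h1 hx, h2 hx]; ring
  integral_le := by
    rw [integral_add (hu.integrable.const_mul a) (hv.integrable.const_mul b),
      integral_const_mul, integral_const_mul]
    have h1 := mul_le_mul_of_nonneg_left hu.integral_le ha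
    have h2 := mul_le_mul_of_nonneg_left hv.integral_le hb
    have h3 : a * lam + b * lam = lam := by rw [← add_mul, hab, one_mul]
    linarith

lemma of_tendsto {w : ℕ → E3 → ℝ} (hw : ∀ n, AdmR Ωp lam (w n)) (hlam : 0 ≤ lam)
    (hv : AEStronglyMeasurable v) (h : ∀ᵐ x, Tendsto (fun n => w n x) atTop (𝓝 (v x))) :
    AdmR Ωp lam v := by
  have h0 : ∀ᵐ x, 0 ≤ v x := by
    filter_upwards [h, ae_all_iff.2 fun n => (hw n).nonneg] with x hx hx2
    exact ge_of_tendsto' hx hx2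
  have he : ∀ n, eLpNorm (w n) 1 volume ≤ ENNReal.ofReal lam := fun n => by
    rw [eLpNorm_one_eq_lintegral_enorm, ← ofReal_integral_norm_eq_lintegral_enorm (hw n).integrable]
    exact ENNReal.ofReal_le_ofReal (hw n).integral_abs_le
  have hle : eLpNorm v 1 volume ≤ ENNReal.ofReal lam := by
    refine (Lp.eLpNorm_lim_le_liminf_eLpNorm (fun n => (hw n).integrable.1) v h).trans ?_
    refine (liminf_le_liminf (Eventually.of_forall he)).trans ?_
    simp
  have hi : Integrable v := memLp_one_iff_integrable.1 ⟨hv, hle.trans_lt ENNReal.ofReal_lt_top⟩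
  refine ⟨hi, h0, ?_, ?_, ?_⟩
  · filter_upwards [h, ae_all_iff.2 fun n => (hw n).le_one] with x hx hx2
    exact le_of_tendsto' hx hx2
  · filter_upwards [h, ae_all_iff.2 fun n => (hw n).eq_zero] with x hx hx2 hxp
    refine tendsto_nhds_unique hx ?_
    simp only [hx2 _ hxp]
    exact tendsto_const_nhds
  · rw [eLpNorm_one_eq_lintegral_enorm, ← ofReal_integral_norm_eq_lintegral_enorm hi,
      ENNReal.ofReal_le_ofReal_iff hlam] at hle
    refine le_trans (le_of_eq (integral_congr_ae ?_)) hle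
    filter_upwards [h0] with x hx
    rw [norm_of_nonneg hx]

end AdmR

lemma integral_sq_eq_norm_sq (v : Lp ℝ 2 (volume : Measure E3)) : ∫ x, v x ^ 2 = ‖v‖ ^ 2 := by
  rw [← real_inner_self_eq_norm_sq, L2.inner_def]
  simp [sq]

/-- Potentials of charge densities with bounded mass are uniformly small when
the `L²` norm is small. -/
lemma exists_integral_sq_pot_lt (M : ℝ) {e : ℝ} (he : 0 < e) :
    ∃ d > 0, ∀ δ : E3 → ℝ, Charge δ → ∫ x, |δ x| ≤ M → ∫ x, δ x ^ 2 < d ^ 2 →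
      ∀ x, |pot δ x| ≤ e := by
  set M' := max M 0 with hM'
  have hM0 : 0 ≤ M' := le_max_right _ _
  set R := (M' + 1) / e with hR
  have hR0 : 0 < R := by positivity
  set A := ∫ z in ball (0 : E3) R, newt z ^ 2 with hA
  have hA0 : 0 ≤ A := integral_nonneg fun z => sq_nonneg _
  set ε := e / (A + 1) with hε
  have hε0 : 0 < ε := by positivity
  refine ⟨√(e * ε / 2), by positivity, fun δ hδ h1 h2 x => ?_⟩
  rw [Real.sq_sqrt (by positivity)] at h2
  refine (abs_pot_le δ x).trans ((hδ.integral_coul_mul_abs_le x hR0 hε0).trans ?_)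
  have h3 : ε / 2 * A ≤ e / 2 := by
    rw [hε]
    rw [div_div, div_mul_eq_mul_div, div_le_div_iff₀ (by positivity) (by norm_num)]
    nlinarith
  have h4 : 1 / (2 * ε) * ∫ y, δ y ^ 2 ≤ e / 4 := by
    calc 1 / (2 * ε) * ∫ y, δ y ^ 2 ≤ 1 / (2 * ε) * (e * ε / 2) := by gcongr
      _ = e / 4 := by field_simp; norm_num
  have h5 : 1 / (4 * π * R) * ∫ y, |δ y| ≤ e / 4 := by
    have h6 : ∫ y, |δ y| ≤ M' := h1.trans (le_max_left _ _)
    have := pi_gt_three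
    calc 1 / (4 * π * R) * ∫ y, |δ y| ≤ 1 / (4 * π * R) * M' := by gcongr
      _ ≤ e / 4 := by
        rw [hR, one_div, inv_mul_le_iff₀ (by positivity)]
        field_simp
        nlinarith
  linarith

lemma interaction_self_sub {ρ σ : E3 → ℝ} (hρ : Charge ρ) (hσ : Charge σ) :
    interaction ρ ρ - interaction σ σ
      = interaction (fun x => ρ x + σ x) (fun x => ρ x - σ x) := by
  have h2 := interaction_self_add_const_mul hσ (hρ.sub hσ) 1
  simp only [one_mul, add_sub_cancel] at h2
  have h3 := interaction_add_left (hρ.sub hσ) (hσ.const_mul 2) (hρ.sub hσ)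
  rw [interaction_const_mul_left] at h3
  have h4 : (fun x => ρ x + σ x) = fun x => ρ x - σ x + 2 * σ x := by funext x; ring
  rw [h4, h3, h2]
  ring

/-- Existence of minimizers for the relaxed problem. -/
lemma exists_relaxed_minimizer {Ωp : Set E3} (hΩ : MeasurableSet Ωp) {lam : ℝ} (hlam : 0 ≤ lam)
    {f : E3 → ℝ} (hf : Charge f) :
    ∃ u : E3 → ℝ, Measurable u ∧ (∀ x, 0 ≤ u x) ∧ (∀ x, u x ≤ 1) ∧ (∀ x ∈ Ωp, u x = 0) ∧
      AdmR Ωp lam u ∧ ∀ v, AdmR Ωp lam v →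
        interaction (fun x => f x - u x) (fun x => f x - u x)
          ≤ interaction (fun x => f x - v x) (fun x => f x - v x) := by
  set K : Set (Lp ℝ 2 (volume : Measure E3)) := {v | AdmR Ωp lam v} with hK
  set F : Lp ℝ 2 (volume : Measure E3) → ℝ := fun v =>
    interaction (fun x => f x - v x) (fun x => f x - v x) with hF
  have hne : K.Nonempty := by
    refine ⟨0, AdmR.congr (v := fun _ => 0) ⟨?_, ?_, ?_, ?_, ?_⟩ (Lp.coeFn_zero _ _ _).symm⟩
    · exact integrable_zero _ _ _
    · simp
    · simp
    · simp
    · simpa using hlam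
  have hcl : IsClosed K := by
    refine IsSeqClosed.isClosed fun w v hw hv => ?_
    obtain ⟨ns, -, hns⟩ := (tendstoInMeasure_of_tendsto_Lp hv).exists_seq_tendsto_ae
    exact AdmR.of_tendsto (fun n => hw (ns n)) hlam (Lp.aestronglyMeasurable v) hns
  have hbd : ∀ v ∈ K, ‖v‖ ≤ √lam := by
    intro v hv
    have hv : AdmR Ωp lam v := hv
    refine Real.le_sqrt_of_sq_le ?_
    rw [← integral_sq_eq_norm_sq]
    refine (integral_mono_ae hv.charge.2.integrable_sq hv.integrable ?_).trans hv.integral_le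
    filter_upwards [hv.nonneg, hv.le_one] with x h0 h1
    nlinarith
  have hcomb : ∀ (v w : Lp ℝ 2 (volume : Measure E3)) (a b : ℝ),
      (a • v + b • w : Lp ℝ 2 (volume : Measure E3)) =ᵐ[volume] fun x => a * v x + b * w x := by
    intro v w a b
    filter_upwards [Lp.coeFn_add (a • v) (b • w), Lp.coeFn_smul a v, Lp.coeFn_smul b w]
      with x h1 h2 h3
    simp only [h1, Pi.add_apply, h2, h3, Pi.smul_apply, smul_eq_mul]
  have hconv : ConvexOn ℝ K F := by
    refine ⟨fun v hv w hw a b ha hb hab => ?_, fun v hv w hw a b ha hb hab => ?_⟩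
    · exact (AdmR.convex_comb hv hw ha hb hab).congr (hcomb v w a b).symm
    · have hv : AdmR Ωp lam v := hv
      have hw : AdmR Ωp lam w := hw
      have h1 := interaction_self_convex_comb (hf.sub hv.charge) (hf.sub hw.charge) a
      have h2 := interaction_self_nonneg ((hf.sub hv.charge).sub (hf.sub hw.charge))
      have h3 : (fun x => f x - (a • v + b • w : Lp ℝ 2 (volume : Measure E3)) x) =ᵐ[volume]
          fun x => f x - w x + a * (f x - v x - (f x - w x)) := by
        filter_upwards [hcomb v w a b] with x hx
        rw [hx, show b = 1 - a by linarith]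
        ring
      simp only [hF]
      rw [interaction_congr h3 h3, h1, smul_eq_mul, smul_eq_mul, show b = 1 - a by linarith]
      have : 0 ≤ a * (1 - a) := mul_nonneg ha (by linarith)
      nlinarith
  have hcont : ContinuousOn F K := by
    rw [Metric.continuousOn_iff]
    intro v hv e he
    have hv : AdmR Ωp lam v := hv
    set m := ∫ x, |f x| with hm
    have hm0 : 0 ≤ m := integral_nonneg fun x => abs_nonneg _
    obtain ⟨d, hd, hpot⟩ := exists_integral_sq_pot_lt (2 * lam)
      (e := e / (2 * (2 * m + 2 * lam + 1))) (by positivity)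
    refine ⟨d, hd, fun u hu hdist => ?_⟩
    have hu : AdmR Ωp lam u := hu
    have hδ : Charge fun x => f x - u x - (f x - v x) :=
      (hf.sub hu.charge).sub (hf.sub hv.charge)
    have hsq : ∫ x, (f x - u x - (f x - v x)) ^ 2 = ‖u - v‖ ^ 2 := by
      rw [← integral_sq_eq_norm_sq]
      refine integral_congr_ae ?_
      filter_upwards [Lp.coeFn_sub u v] with x hx
      rw [hx, Pi.sub_apply]
      ring
    have habs : ∫ x, |f x - u x - (f x - v x)| ≤ 2 * lam := by
      calc ∫ x, |f x - u x - (f x - v x)| ≤ ∫ x, (|u x| + |v x|) := by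
            refine integral_mono hδ.1.abs (hu.integrable.abs.add hv.integrable.abs) fun x => ?_
            have : f x - u x - (f x - v x) = v x - u x := by ring
            simp only [this]
            exact (abs_sub _ _).trans (le_of_eq (add_comm _ _))
        _ = (∫ x, |u x|) + ∫ x, |v x| := integral_add hu.integrable.abs hv.integrable.abs
        _ ≤ 2 * lam := by linarith [hu.integral_abs_le, hv.integral_abs_le]
    have hp := hpot _ hδ habs (by
      rw [hsq]
      rw [dist_eq_norm] at hdist
      gcongr)
    rw [Real.dist_eq]
    simp only [hF]
    rw [interaction_self_sub (hf.sub hu.charge) (hf.sub hv.charge)]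
    have hs := (hf.sub hu.charge).add (hf.sub hv.charge)
    calc |interaction (fun x => f x - u x + (f x - v x)) fun x => f x - u x - (f x - v x)|
        ≤ ∫ x, |(f x - u x + (f x - v x)) * pot (fun x => f x - u x - (f x - v x)) x| :=
          abs_integral_le_integral_abs
      _ ≤ ∫ x, (2 * |f x| + (|u x| + |v x|)) * (e / (2 * (2 * m + 2 * lam + 1))) := by
          refine integral_mono (hδ.integrable_mul_pot hs.1).abs
            (((hf.1.abs.const_mul 2).add
              (hu.integrable.abs.add hv.integrable.abs)).mul_const _) fun x => ?_
          simp only [abs_mul]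
          refine mul_le_mul ?_ (hp x) (abs_nonneg _) (by positivity)
          have h1 := abs_add_le (f x - u x) (f x - v x)
          have h2 := abs_sub (f x) (u x)
          have h3 := abs_sub (f x) (v x)
          linarith
      _ = (2 * m + ((∫ x, |u x|) + ∫ x, |v x|)) * (e / (2 * (2 * m + 2 * lam + 1))) := by
          rw [integral_mul_const]
          congr 1
          have i1 : Integrable fun x => |u x| + |v x| := hu.integrable.abs.add hv.integrable.abs
          rw [integral_add (hf.1.abs.const_mul 2) i1, integral_const_mul,
            integral_add hu.integrable.abs hv.integrable.abs]
      _ ≤ (2 * m + 2 * lam) * (e / (2 * (2 * m + 2 * lam + 1))) := by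
          gcongr
          linarith [hu.integral_abs_le, hv.integral_abs_le]
      _ < e := by
          rw [mul_div_assoc', div_lt_iff₀ (by positivity)]
          nlinarith
  obtain ⟨u, hu, humin⟩ := ConvexOn.exists_isMinOn_of_isClosed_of_bounded hne hcl hbd hconv hcont
    ⟨0, by
      rintro _ ⟨v, hv, rfl⟩
      exact interaction_self_nonneg (hf.sub (AdmR.charge hv))⟩
  have hu : AdmR Ωp lam u := hu
  have hum := (Lp.stronglyMeasurable u).measurable
  set u' : E3 → ℝ := Ωpᶜ.indicator fun x => max 0 (min 1 (u x)) with hu'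
  have huu : (u : E3 → ℝ) =ᵐ[volume] u' := by
    filter_upwards [hu.nonneg, hu.le_one, hu.eq_zero] with x h0 h1 h2
    by_cases hx : x ∈ Ωp
    · rw [hu', indicator_of_notMem (by simpa using hx), h2 hx]
    · rw [hu', indicator_of_mem (by simpa using hx), min_eq_right h1, max_eq_right h0]
  refine ⟨u', (by fun_prop : Measurable fun x => max 0 (min 1 (u x))).indicator hΩ.compl,
    fun x => indicator_nonneg (fun _ _ => le_max_left _ _) x, fun x => ?_, fun x hx => ?_,
    hu.congr huu, fun v hv => ?_⟩
  · exact indicator_le' (fun _ _ => max_le zero_le_one (min_le_left _ _))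
      (fun _ _ => zero_le_one) x
  · rw [hu', indicator_of_notMem (by simpa using hx)]
  · have hmv := hv.charge.2
    have h1 : AdmR Ωp lam hmv.toLp := hv.congr hmv.coeFn_toLp.symm
    have h2 := humin _ h1
    simp only [hF] at h2
    have h3 : (fun x => f x - u x) =ᵐ[volume] fun x => f x - u' x := by
      filter_upwards [huu] with x hx
      rw [hx]
    have h4 : (fun x => f x - (hmv.toLp : Lp ℝ 2 (volume : Measure E3)) x) =ᵐ[volume] fun x => f x - v x := by
      filter_upwards [hmv.coeFn_toLp] with x hx
      rw [hx]
    rwa [interaction_congr h3 h3, interaction_congr h4 h4] at h2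

/-- The first variation inequality at a minimizer of the relaxed problem. -/
lemma interaction_nonpos_of_relaxed_minimizer {Ωp : Set E3} {lam : ℝ} {f u v : E3 → ℝ}
    (hf : Charge f) (hu : AdmR Ωp lam u)
    (hmin : ∀ v, AdmR Ωp lam v → interaction (fun x => f x - u x) (fun x => f x - u x)
      ≤ interaction (fun x => f x - v x) (fun x => f x - v x))
    (hv : AdmR Ωp lam v) :
    interaction (fun x => f x - u x) (fun x => v x - u x) ≤ 0 := by
  set ρ : E3 → ℝ := fun x => f x - u x with hρ
  set σ : E3 → ℝ := fun x => v x - u x with hσ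
  have hρc : Charge ρ := hf.sub hu.charge
  have hσc : Charge σ := hv.charge.sub hu.charge
  have key : ∀ t ∈ Ioo (0 : ℝ) 1, interaction ρ σ ≤ t / 2 * interaction σ σ := by
    intro t ht
    have h1 := hmin _ (hu.convex_comb hv (a := 1 - t) (b := t) (by linarith [ht.2]) ht.1.le (by ring))
    have h2 : (fun x => f x - ((1 - t) * u x + t * v x)) = fun x => ρ x + -t * σ x := by
      funext x; simp only [hρ, hσ]; ring
    rw [h2, interaction_self_add_const_mul hρc hσc] at h1
    have ht0 := ht.1
    have h3 : t * interaction ρ σ ≤ t * (t / 2 * interaction σ σ) := by linarith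
    exact le_of_mul_le_mul_left h3 ht0
  have hlim : Tendsto (fun t : ℝ => t / 2 * interaction σ σ) (𝓝[>] 0) (𝓝 0) := by
    have : Continuous fun t : ℝ => t / 2 * interaction σ σ := by fun_prop
    have := this.tendsto 0
    rw [zero_div, zero_mul] at this
    exact this.mono_left nhdsWithin_le_nhds
  refine ge_of_tendsto hlim ?_
  filter_upwards [Ioo_mem_nhdsGT one_pos] with t ht using key t ht

lemma pot_tent_smul {R : ℝ} (hR : 0 < R) (y : E3) :
    pot (fun x => tent (R⁻¹ • x)) y = R ^ 2 * pot tent (R⁻¹ • y) := by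
  have h := Measure.integral_comp_smul (volume : Measure E3)
    (fun z => coul y z * tent (R⁻¹ • z)) R
  have hd : Module.finrank ℝ E3 = 3 := by simp
  rw [hd, abs_of_pos (by positivity), smul_eq_mul] at h
  have h2 : ∀ z, coul y (R • z) * tent (R⁻¹ • R • z) = R⁻¹ * (coul (R⁻¹ • y) z * tent z) := by
    intro z
    rw [inv_smul_smul₀ hR.ne', coul_eq_newt, coul_eq_newt, ← mul_assoc, ← newt_smul hR, smul_sub,
      smul_inv_smul₀ hR.ne']
  simp only [h2, integral_const_mul] at h
  have h3 : (∫ z, coul y z * tent (R⁻¹ • z)) = R ^ 3 * (R⁻¹ * ∫ z, coul (R⁻¹ • y) z * tent z) := by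
    rw [h, mul_inv_cancel_left₀ (by positivity)]
  rw [pot, pot, h3]
  field_simp

/-- If a minimizer of the relaxed problem does not use all the available mass, the net charge
repels any further negative charge, up to a bounded error. -/
lemma interaction_le_of_integral_lt {Ωp : Set E3} {lam : ℝ} {f u g : E3 → ℝ}
    (hf : Charge f) (hfΩ : ∀ x ∈ Ωp, f x = 1) (hfΩ' : ∀ x, x ∉ Ωp → f x = 0)
    (hu0 : ∀ x, 0 ≤ u x) (hu1 : ∀ x, u x ≤ 1) (huΩ : ∀ x ∈ Ωp, u x = 0)
    (hu : AdmR Ωp lam u)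
    (hmin : ∀ v, AdmR Ωp lam v → interaction (fun x => f x - u x) (fun x => f x - u x)
      ≤ interaction (fun x => f x - v x) (fun x => f x - v x))
    (hlt : ∫ x, u x < lam) (hgch : Charge g) (hg0 : ∀ x, 0 ≤ g x) (hg1 : ∀ x, g x ≤ 1)
    {C : ℝ} (hC0 : 0 ≤ C) (hC : ∀ x, |pot (fun x => f x - u x) x| ≤ C) :
    interaction g (fun x => f x - u x) ≤ C * ∫ x, (u x + f x) := by
  set ρ : E3 → ℝ := fun x => f x - u x with hρ
  have hρc : Charge ρ := hf.sub hu.charge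
  have huf : ∀ x, 0 ≤ u x + f x ∧ u x + f x ≤ 1 := by
    intro x
    by_cases hx : x ∈ Ωp
    · rw [huΩ x hx, hfΩ x hx]; norm_num
    · rw [hfΩ' x hx, add_zero]; exact ⟨hu0 x, hu1 x⟩
  have hufc : Charge fun x => u x + f x := hu.charge.add hf
  set τ : E3 → ℝ := fun x => g x * (u x + f x) with hτ
  have hτb : ∀ x, |τ x| ≤ u x + f x := fun x => by
    rw [hτ, abs_of_nonneg (mul_nonneg (hg0 x) (huf x).1)]
    exact mul_le_of_le_one_left (huf x).1 (hg1 x)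
  have hτi : Integrable τ := hufc.1.mono' (hgch.1.1.mul hufc.1.1) (ae_of_all _ hτb)
  have hτc : Charge τ := Charge.of_bound hτi (C := 1)
    (ae_of_all _ fun x => (hτb x).trans (huf x).2)
  set η : E3 → ℝ := fun x => g x - τ x with hη
  have hηc : Charge η := hgch.sub hτc
  have hη' : ∀ x, η x = g x * (1 - (u x + f x)) := fun x => by simp only [hη, hτ]; ring
  have hη0 : ∀ x, 0 ≤ η x := fun x => by
    rw [hη']; exact mul_nonneg (hg0 x) (by linarith [(huf x).2])
  have hηi0 : 0 ≤ ∫ x, η x := integral_nonneg hη0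
  have hηle : ∀ x, η x ≤ 1 - (u x + f x) := fun x => by
    rw [hη']; exact mul_le_of_le_one_left (by linarith [(huf x).2]) (hg1 x)
  set t := min 1 ((lam - ∫ x, u x) / ((∫ x, η x) + 1)) with ht
  have ht0 : 0 < t := lt_min one_pos (div_pos (by linarith) (by linarith))
  have ht1 : t ≤ 1 := min_le_left _ _
  have ht2 : t * ∫ x, η x ≤ lam - ∫ x, u x := by
    have h1 : t ≤ (lam - ∫ x, u x) / ((∫ x, η x) + 1) := min_le_right _ _
    rw [le_div_iff₀ (by linarith)] at h1
    linarith
  have hv : AdmR Ωp lam fun x => u x + t * η x := by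
    refine ⟨hu.integrable.add (hηc.1.const_mul t), ae_of_all _ fun x => ?_,
      ae_of_all _ fun x => ?_, ae_of_all _ fun x hx => ?_, ?_⟩
    · have := hu0 x
      have := hη0 x
      positivity
    · have h1 : t * η x ≤ η x := mul_le_of_le_one_left (hη0 x) ht1
      have h2 := hηle x
      have h3 : 0 ≤ f x := by
        by_cases hx : x ∈ Ωp
        · rw [hfΩ x hx]; norm_num
        · rw [hfΩ' x hx]
      linarith
    · rw [hη', huΩ x hx, hfΩ x hx]; ring
    · rw [integral_add hu.integrable (hηc.1.const_mul t), integral_const_mul]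
      linarith
  have h1 := interaction_nonpos_of_relaxed_minimizer hf hu hmin hv
  have h2 : (fun x => u x + t * η x - u x) = fun x => t * η x := by funext x; ring
  rw [h2, interaction_comm hρc (hηc.const_mul t), interaction_const_mul_left] at h1
  have h3 : interaction η ρ ≤ 0 := by
    by_contra! h
    exact absurd h1 (not_le.2 (mul_pos ht0 h))
  have h4 : interaction η ρ = interaction g ρ - interaction τ ρ := by
    have : η = fun x => g x + -1 * τ x := by funext x; simp only [hη]; ring
    rw [this, interaction_add_left hgch (hτc.const_mul (-1)) hρc, interaction_const_mul_left]
    ring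
  have h5 : interaction τ ρ ≤ C * ∫ x, (u x + f x) := by
    rw [← integral_const_mul]
    refine integral_mono (hρc.integrable_mul_pot hτi) (hufc.1.const_mul C) fun x => ?_
    refine (le_abs_self _).trans ?_
    simp only [abs_mul]
    rw [mul_comm]
    exact mul_le_mul (hC x) (hτb x) (abs_nonneg _) hC0
  linarith

/-- Minimizers of the relaxed problem use all the available mass. -/
lemma integral_eq_of_relaxed_minimizer {Ωp : Set E3} {lam : ℝ} {f u : E3 → ℝ}
    (hf : Charge f) (hfΩ : ∀ x ∈ Ωp, f x = 1) (hfΩ' : ∀ x, x ∉ Ωp → f x = 0)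
    (hlam : lam ≤ ∫ x, f x)
    (hu0 : ∀ x, 0 ≤ u x) (hu1 : ∀ x, u x ≤ 1) (huΩ : ∀ x ∈ Ωp, u x = 0)
    (hu : AdmR Ωp lam u)
    (hmin : ∀ v, AdmR Ωp lam v → interaction (fun x => f x - u x) (fun x => f x - u x)
      ≤ interaction (fun x => f x - v x) (fun x => f x - v x)) :
    ∫ x, u x = lam := by
  refine le_antisymm hu.integral_le (not_lt.1 fun hlt => ?_)
  set ρ : E3 → ℝ := fun x => f x - u x with hρ
  have hρc : Charge ρ := hf.sub hu.charge
  have hρi : 0 < ∫ x, ρ x := by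
    rw [hρ, integral_sub hf.1 hu.integrable]
    linarith
  obtain ⟨C, hC0, hC⟩ := hρc.exists_pot_bound
  set D := C * ∫ x, (u x + f x) with hD
  have key : ∀ R : ℝ, 0 < R → ∫ y, ρ y * pot tent (R⁻¹ • y) ≤ D * (R⁻¹) ^ 2 := by
    intro R hR
    set g : E3 → ℝ := fun x => tent (R⁻¹ • x) with hg
    have hg0 : ∀ x, 0 ≤ g x := fun x => tent_nonneg _
    have hg1 : ∀ x, g x ≤ 1 := fun x => tent_le_one _
    have hgi : Integrable g := integrable_tent.comp_smul (inv_ne_zero hR.ne')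
    have hgch : Charge g := Charge.of_bound hgi (ae_of_all _ fun x => abs_tent_le_one _)
    have h5 := interaction_le_of_integral_lt hf hfΩ hfΩ' hu0 hu1 huΩ hu hmin hlt hgch hg0 hg1 hC0
      fun x => (abs_pot_le ρ x).trans (hC x)
    have h6 : interaction g ρ = R ^ 2 * ∫ y, ρ y * pot tent (R⁻¹ • y) := by
      rw [interaction_comm hgch hρc, interaction, ← integral_const_mul]
      congr 1
      funext y
      rw [hg, pot_tent_smul hR]
      ring
    have h7 : R ^ 2 * ∫ y, ρ y * pot tent (R⁻¹ • y) ≤ D := h6 ▸ h5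
    rw [inv_pow, ← div_eq_mul_inv, le_div_iff₀ (by positivity), mul_comm]
    exact h7
  obtain ⟨C', hC'0, hC'⟩ := charge_tent.exists_pot_bound
  have hlim : Tendsto (fun R : ℝ => ∫ y, ρ y * pot tent (R⁻¹ • y)) atTop
      (𝓝 (∫ y, ρ y * pot tent 0)) := by
    refine tendsto_integral_filter_of_dominated_convergence (fun y => |ρ y| * C') ?_ ?_ ?_ ?_
    · refine Eventually.of_forall fun R => hρc.1.1.mul ?_
      exact (continuous_pot_tent.comp (by fun_prop)).aestronglyMeasurable
    · refine Eventually.of_forall fun R => ae_of_all _ fun y => ?_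
      rw [norm_mul, norm_eq_abs, norm_eq_abs]
      exact mul_le_mul_of_nonneg_left ((abs_pot_le _ _).trans (hC' _)) (abs_nonneg _)
    · exact hρc.1.abs.mul_const _
    · refine ae_of_all _ fun y => ?_
      have h1 : Tendsto (fun R : ℝ => R⁻¹ • y) atTop (𝓝 ((0 : ℝ) • y)) :=
        tendsto_inv_atTop_zero.smul_const y
      rw [zero_smul] at h1
      exact ((continuous_pot_tent.tendsto 0).comp h1).const_mul (ρ y)
  have hlim2 : Tendsto (fun R : ℝ => D * R⁻¹ ^ 2) atTop (𝓝 (D * 0 ^ 2)) :=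
    (tendsto_inv_atTop_zero.pow 2).const_mul D
  have hfin := le_of_tendsto_of_tendsto hlim hlim2
    ((eventually_gt_atTop (0 : ℝ)).mono fun R hR => key R hR)
  rw [integral_mul_const] at hfin
  have := mul_pos hρi pot_tent_zero_pos
  simp only [ne_eq, OfNat.ofNat_ne_zero, not_false_eq_true, zero_pow, mul_zero] at hfin
  linarith

/-- Minimizers of the relaxed problem take only the values `0` and `1`. -/
lemma ae_eq_zero_or_one_of_relaxed_minimizer {Ωp : Set E3} {lam : ℝ} {f u : E3 → ℝ}
    (hf : Charge f) (hfm : Measurable f) (hfΩ : ∀ x ∈ Ωp, f x = 1) (hfΩ' : ∀ x, x ∉ Ωp → f x = 0)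
    (hum : Measurable u) (hu0 : ∀ x, 0 ≤ u x) (hu1 : ∀ x, u x ≤ 1) (huΩ : ∀ x ∈ Ωp, u x = 0)
    (hu : AdmR Ωp lam u)
    (hmin : ∀ v, AdmR Ωp lam v → interaction (fun x => f x - u x) (fun x => f x - u x)
      ≤ interaction (fun x => f x - v x) (fun x => f x - v x)) :
    ∀ᵐ x, u x = 0 ∨ u x = 1 := by
  set ρ : E3 → ℝ := fun x => f x - u x with hρ
  have hρc : Charge ρ := hf.sub hu.charge
  have hρm : Measurable ρ := hfm.sub hum
  have hρb : ∀ x, |ρ x| ≤ 1 := by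
    intro x
    rw [abs_le]
    simp only [hρ]
    by_cases hx : x ∈ Ωp
    · rw [huΩ x hx, hfΩ x hx]; norm_num
    · rw [hfΩ' x hx]; constructor <;> linarith [hu0 x, hu1 x]
  obtain ⟨C, hC0, hC⟩ := hρc.exists_pot_bound
  have hφ : ∀ x, |pot ρ x| ≤ C := fun x => (abs_pot_le ρ x).trans (hC x)
  set w : E3 → ℝ := fun x => u x * (1 - u x) with hw
  have hw0 : ∀ x, 0 ≤ w x := fun x => mul_nonneg (hu0 x) (by linarith [hu1 x])
  have hwu : ∀ x, w x ≤ u x := fun x => mul_le_of_le_one_right (hu0 x) (by linarith [hu0 x])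
  have hwu' : ∀ x, w x ≤ 1 - u x := fun x => mul_le_of_le_one_left (by linarith [hu1 x]) (hu1 x)
  have hwm : Measurable w := hum.mul (measurable_const.sub hum)
  have hwi : Integrable w := hu.integrable.mono' hwm.aestronglyMeasurable
    (ae_of_all _ fun x => by rw [norm_of_nonneg (hw0 x)]; exact hwu x)
  have hval : ∀ x, w x = 0 → u x = 0 ∨ u x = 1 := by
    intro x hx
    rcases mul_eq_zero.1 hx with h | h
    · exact Or.inl h
    · exact Or.inr (by linarith)
  suffices hae : ∀ᵐ x, w x = 0 by filter_upwards [hae] with x hx using hval x hx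
  by_cases hW : ∫ x, w x = 0
  · exact (integral_eq_zero_iff_of_nonneg hw0 hwi).1 hW
  set c := (∫ x, w x * pot ρ x) / ∫ x, w x with hc
  set B := C + |c| + 1 with hB
  have hB0 : 0 < B := by positivity
  have hφc : ∀ x, |pot ρ x - c| ≤ B := fun x => by
    have := abs_sub (pot ρ x) c
    linarith [hφ x]
  have hwφ : Integrable fun x => w x * pot ρ x := hρc.integrable_mul_pot hwi
  set η : E3 → ℝ := fun x => w x * (pot ρ x - c) with hη
  have hη' : η = fun x => w x * pot ρ x - w x * c := by funext x; simp only [hη]; ring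
  have hηi : Integrable η := by rw [hη']; exact hwφ.sub (hwi.mul_const c)
  have hηb : ∀ x, |B⁻¹ * η x| ≤ w x := fun x => by
    rw [abs_mul, abs_of_pos (inv_pos.2 hB0), inv_mul_le_iff₀ hB0]
    simp only [hη, abs_mul]
    rw [abs_of_nonneg (hw0 x), mul_comm B]
    exact mul_le_mul_of_nonneg_left (hφc x) (hw0 x)
  have hη_int : ∫ x, η x = 0 := by
    rw [hη', integral_sub hwφ (hwi.mul_const c), integral_mul_const, hc]
    field_simp
    ring
  have hηc : Charge η := Charge.of_bound hηi (C := B) (ae_of_all _ fun x => by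
    simp only [hη, abs_mul]
    rw [abs_of_nonneg (hw0 x)]
    exact (mul_le_of_le_one_left (abs_nonneg _) ((hwu x).trans (hu1 x))).trans (hφc x))
  have hv : AdmR Ωp lam fun x => u x + B⁻¹ * η x := by
    refine ⟨hu.integrable.add (hηi.const_mul _), ae_of_all _ fun x => ?_,
      ae_of_all _ fun x => ?_, ae_of_all _ fun x hx => ?_, ?_⟩
    · linarith [(abs_le.1 (hηb x)).1, hwu x]
    · linarith [(abs_le.1 (hηb x)).2, hwu' x]
    · simp only [hη, hw]; rw [huΩ x hx]; ring
    · rw [integral_add hu.integrable (hηi.const_mul _), integral_const_mul, hη_int]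
      linarith [hu.integral_le]
  have h1 := interaction_nonpos_of_relaxed_minimizer hf hu hmin hv
  have h2 : (fun x => u x + B⁻¹ * η x - u x) = fun x => B⁻¹ * η x := by funext x; ring
  rw [h2, interaction_comm hρc (hηc.const_mul _), interaction_const_mul_left] at h1
  have h3 : interaction η ρ ≤ 0 := by
    by_contra! h
    exact absurd h1 (not_le.2 (mul_pos (inv_pos.2 hB0) h))
  have hηφ := hρc.integrable_mul_pot hηi
  have h4 : ∫ x, w x * (pot ρ x - c) ^ 2 = interaction η ρ := by
    have : (fun x => w x * (pot ρ x - c) ^ 2) = fun x => η x * pot ρ x - η x * c := by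
      funext x; simp only [hη]; ring
    rw [this, integral_sub hηφ (hηi.mul_const c), integral_mul_const, hη_int, zero_mul, sub_zero,
      interaction]
  have h5 : Integrable fun x => w x * (pot ρ x - c) ^ 2 := by
    have : (fun x => w x * (pot ρ x - c) ^ 2) = fun x => η x * pot ρ x - η x * c := by
      funext x; simp only [hη]; ring
    rw [this]
    exact hηφ.sub (hηi.mul_const c)
  have h6 : ∀ x, 0 ≤ w x * (pot ρ x - c) ^ 2 := fun x => mul_nonneg (hw0 x) (sq_nonneg _)
  have h7 : ∀ᵐ x, w x * (pot ρ x - c) ^ 2 = 0 :=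
    (integral_eq_zero_iff_of_nonneg h6 h5).1 (le_antisymm (h4.le.trans h3) (integral_nonneg h6))
  have h8 : ∀ n : ℕ, ∀ᵐ x, x ∈ ball (0 : E3) n → w x ≠ 0 → pot ρ x = c → ρ x = 0 := by
    intro n
    have := ae_eq_zero_of_pot_const lapMass_ne_zero hρc.1 hρm hρb
      (S := ball 0 n ∩ pot ρ ⁻¹' {c})
      (measurableSet_ball.inter (measurable_pot hρm (measurableSet_singleton c)))
      ((measure_mono inter_subset_left).trans_lt measure_ball_lt_top).ne (κ := c)
      fun x hx => hx.2
    filter_upwards [this] with x hx hxn _ hxc using hx ⟨hxn, hxc⟩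
  filter_upwards [h7, ae_all_iff.2 h8] with x hx hx8
  by_contra hne
  have hxc : pot ρ x = c := by
    have := pow_eq_zero_iff (two_ne_zero) |>.1 ((mul_eq_zero.1 hx).resolve_left hne)
    linarith
  obtain ⟨n, hn⟩ := exists_nat_gt ‖x‖
  have h9 := hx8 n (mem_ball_zero_iff.2 hn) hne hxc
  have hxΩ : x ∉ Ωp := fun h => hne (by simp only [hw]; rw [huΩ x h, zero_mul])
  simp only [hρ] at h9
  rw [hfΩ' x hxΩ, zero_sub, neg_eq_zero] at h9
  exact hne (by simp only [hw]; rw [h9, zero_mul])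

/-- The charge density of a uniformly charged set. -/
def unitCharge (A : Set E3) : E3 → ℝ := A.indicator fun _ => 1

lemma unitCharge_of_mem {A : Set E3} {x : E3} (hx : x ∈ A) : unitCharge A x = 1 :=
  indicator_of_mem hx _

lemma unitCharge_of_notMem {A : Set E3} {x : E3} (hx : x ∉ A) : unitCharge A x = 0 :=
  indicator_of_notMem hx _

lemma unitCharge_nonneg (A : Set E3) (x : E3) : 0 ≤ unitCharge A x :=
  indicator_nonneg (fun _ _ => zero_le_one) x

lemma unitCharge_le_one (A : Set E3) (x : E3) : unitCharge A x ≤ 1 :=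
  indicator_le' (fun _ _ => le_rfl) (fun _ _ => zero_le_one) x

lemma measurable_unitCharge {A : Set E3} (hA : MeasurableSet A) : Measurable (unitCharge A) :=
  measurable_const.indicator hA

lemma integrable_unitCharge {A : Set E3} (hA : MeasurableSet A) (hA' : volume A ≠ ⊤) :
    Integrable (unitCharge A) :=
  (integrable_indicator_iff hA).2 (integrableOn_const hA')

lemma charge_unitCharge {A : Set E3} (hA : MeasurableSet A) (hA' : volume A ≠ ⊤) :
    Charge (unitCharge A) :=
  Charge.of_bound (integrable_unitCharge hA hA') (C := 1) (ae_of_all _ fun x => by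
    rw [abs_of_nonneg (unitCharge_nonneg A x)]; exact unitCharge_le_one A x)

lemma integral_unitCharge {A : Set E3} (hA : MeasurableSet A) :
    ∫ x, unitCharge A x = volume.real A := by
  unfold unitCharge
  rw [integral_indicator hA]
  simp

lemma interaction_unitCharge {A B : Set E3} (hA : MeasurableSet A) (hB : MeasurableSet B) :
    interaction (unitCharge A) (unitCharge B) = ∫ x in A, ∫ y in B, coul x y := by
  have h : ∀ x, pot (unitCharge B) x = ∫ y in B, coul x y := by
    intro x
    rw [pot, ← integral_indicator hB]
    congr 1
    funext y
    by_cases hy : y ∈ B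
    · rw [unitCharge_of_mem hy, indicator_of_mem hy, mul_one]
    · rw [unitCharge_of_notMem hy, indicator_of_notMem hy, mul_zero]
  rw [interaction, ← integral_indicator hA]
  congr 1
  funext x
  by_cases hx : x ∈ A
  · rw [unitCharge_of_mem hx, indicator_of_mem hx, one_mul, h]
  · rw [unitCharge_of_notMem hx, indicator_of_notMem hx, zero_mul]

lemma energy_eq_interaction {Ωp A : Set E3} (hΩ : MeasurableSet Ωp) (hΩ' : volume Ωp ≠ ⊤)
    (hA : MeasurableSet A) (hA' : volume A ≠ ⊤) :
    energy Ωp A = interaction (fun x => unitCharge Ωp x - unitCharge A x)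
      (fun x => unitCharge Ωp x - unitCharge A x) := by
  have h := interaction_self_add_const_mul (charge_unitCharge hΩ hΩ') (charge_unitCharge hA hA') (-1)
  simp only [neg_mul, one_mul, ← sub_eq_add_neg] at h
  rw [h, interaction_unitCharge hΩ hΩ, interaction_unitCharge hΩ hA, interaction_unitCharge hA hA,
    energy]
  ring

lemma AdmC.admR {Ωp A : Set E3} {lam : ℝ} (hlam : 0 ≤ lam) (h : AdmC Ωp lam A) :
    AdmR Ωp lam (unitCharge A) := by
  obtain ⟨hA, hΩ, hv⟩ := h
  refine ⟨integrable_unitCharge hA (by rw [hv]; exact ENNReal.ofReal_ne_top),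
    ae_of_all _ (unitCharge_nonneg A), ae_of_all _ (unitCharge_le_one A), ?_, ?_⟩
  · have : ∀ᵐ x, x ∉ Ωp ∩ A := measure_eq_zero_iff_ae_notMem.1 hΩ
    filter_upwards [this] with x hx hxΩ
    exact unitCharge_of_notMem fun hxA => hx ⟨hxΩ, hxA⟩
  · rw [integral_unitCharge hA, measureReal_def, hv, ENNReal.toReal_ofReal hlam]

/-- **Theorem 2.2(1)** (The constrained problem: existence and uniqueness for
`0 < λ ≤ |Ω⁺|`). -/
theorem constrained_existence_uniqueness
    (Ωp : Set E3) (hne : Ωp.Nonempty) (ho : IsOpen Ωp) (hb : Bornology.IsBounded Ωp)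
    (lam : ℝ) (hlam : 0 < lam) (hle : ENNReal.ofReal lam ≤ volume Ωp) :
    ∃ Ωm : Set E3, AdmC Ωp lam Ωm ∧
      (∀ A, AdmC Ωp lam A → energy Ωp Ωm ≤ energy Ωp A) ∧
      (∀ A, AdmC Ωp lam A → (∀ B, AdmC Ωp lam B → energy Ωp A ≤ energy Ωp B) →
        volume (symmDiff A Ωm) = 0) := by
  have hΩ : MeasurableSet Ωp := ho.measurableSet
  have hΩ' : volume Ωp ≠ ⊤ := hb.measure_lt_top.ne
  set f := unitCharge Ωp with hf
  have hfc : Charge f := charge_unitCharge hΩ hΩ'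
  have hfi : lam ≤ ∫ x, f x := by
    rw [integral_unitCharge hΩ, measureReal_def]
    exact (ENNReal.ofReal_le_iff_le_toReal hΩ').1 hle
  obtain ⟨u, hum, hu0, hu1, huΩ, hu, hmin⟩ := exists_relaxed_minimizer hΩ hlam.le hfc
  have hint := integral_eq_of_relaxed_minimizer hfc (fun x hx => unitCharge_of_mem hx)
    (fun x hx => unitCharge_of_notMem hx) hfi hu0 hu1 huΩ hu hmin
  have hbb := ae_eq_zero_or_one_of_relaxed_minimizer hfc (measurable_unitCharge hΩ)
    (fun x hx => unitCharge_of_mem hx) (fun x hx => unitCharge_of_notMem hx) hum hu0 hu1 huΩ hu hmin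
  set Ωm : Set E3 := u ⁻¹' {1} with hΩm
  have hmeas : MeasurableSet Ωm := hum (measurableSet_singleton 1)
  have huA : u =ᵐ[volume] unitCharge Ωm := by
    filter_upwards [hbb] with x hx
    rcases hx with h | h
    · rw [h, unitCharge_of_notMem]
      simp [hΩm, h]
    · rw [h, unitCharge_of_mem]
      exact h
  have hvol : volume.real Ωm = lam := by
    rw [← integral_unitCharge hmeas, ← integral_congr_ae huA, hint]
  have hadm : AdmC Ωp lam Ωm := by
    refine ⟨hmeas, ?_, ?_⟩
    · convert measure_empty (μ := (volume : Measure E3))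
      refine eq_empty_iff_forall_notMem.2 fun x hx => ?_
      have h1 : u x = 1 := hx.2
      rw [huΩ x hx.1] at h1
      exact zero_ne_one h1
    · rw [← hvol, measureReal_def, ENNReal.ofReal_toReal]
      intro h
      rw [measureReal_def, h, ENNReal.toReal_top] at hvol
      exact hlam.ne hvol
  have hfin : ∀ A, AdmC Ωp lam A → volume A ≠ ⊤ := fun A hA => by
    rw [hA.2.2]; exact ENNReal.ofReal_ne_top
  have hen : ∀ A, AdmC Ωp lam A → energy Ωp A =
      interaction (fun x => f x - unitCharge A x) (fun x => f x - unitCharge A x) :=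
    fun A hA => energy_eq_interaction hΩ hΩ' hA.1 (hfin A hA)
  have hρ : (fun x => f x - u x) =ᵐ[volume] fun x => f x - unitCharge Ωm x := by
    filter_upwards [huA] with x hx
    rw [hx]
  have hmin' : ∀ v, AdmR Ωp lam v → energy Ωp Ωm ≤
      interaction (fun x => f x - v x) (fun x => f x - v x) := by
    intro v hv
    rw [hen _ hadm, ← interaction_congr hρ hρ]
    exact hmin v hv
  have hminC : ∀ A, AdmC Ωp lam A → energy Ωp Ωm ≤ energy Ωp A := fun A hA => by
    rw [hen A hA]
    exact hmin' _ (hA.admR hlam.le)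
  refine ⟨Ωm, hadm, hminC, fun A hA hAmin => ?_⟩
  have heq : energy Ωp A = energy Ωp Ωm := le_antisymm (hAmin _ hadm) (hminC A hA)
  set σ : E3 → ℝ := fun x => f x - unitCharge A x - (f x - unitCharge Ωm x) with hσ
  have hcA := charge_unitCharge hA.1 (hfin A hA)
  have hcm := charge_unitCharge hmeas (hfin Ωm hadm)
  have hσc : Charge σ := (hfc.sub hcA).sub (hfc.sub hcm)
  have hcomb := interaction_self_convex_comb (hfc.sub hcA) (hfc.sub hcm) (1 / 2)
  have hmid := hmin' _ ((hA.admR hlam.le).convex_comb (hadm.admR hlam.le)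
    (a := 1 / 2) (b := 1 / 2) (by norm_num) (by norm_num) (by norm_num))
  have hfun : (fun x => f x - (1 / 2 * unitCharge A x + 1 / 2 * unitCharge Ωm x)) =
      fun x => f x - unitCharge Ωm x + 1 / 2 * (f x - unitCharge A x - (f x - unitCharge Ωm x)) := by
    funext x; ring
  rw [hfun, hcomb, ← hen _ hadm, ← hen _ hA, heq] at hmid
  have hσ0 : interaction σ σ = 0 := by
    refine le_antisymm ?_ (interaction_self_nonneg hσc)
    linarith
  have hσm : Measurable σ :=
    ((measurable_unitCharge hΩ).sub (measurable_unitCharge hA.1)).sub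
      ((measurable_unitCharge hΩ).sub (measurable_unitCharge hmeas))
  have hσb : ∀ x, |σ x| ≤ 1 := fun x => by
    rw [abs_le]
    simp only [hσ]
    constructor <;>
      linarith [unitCharge_nonneg A x, unitCharge_le_one A x, unitCharge_nonneg Ωm x,
        unitCharge_le_one Ωm x]
  have hae := ae_eq_zero_of_interaction_self_eq_zero hσc.1 hσm hσb hσ0
  rw [measure_symmDiff_eq_zero_iff]
  filter_upwards [hae] with x hx
  simp only [hσ, Pi.zero_apply] at hx
  refine propext ?_
  change x ∈ A ↔ x ∈ Ωm
  by_cases h1 : x ∈ A <;> by_cases h2 : x ∈ Ωm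
  · exact iff_of_true h1 h2
  · rw [unitCharge_of_mem h1, unitCharge_of_notMem h2] at hx
    norm_num at hx
  · rw [unitCharge_of_notMem h1, unitCharge_of_mem h2] at hx
    norm_num at hx
  · exact iff_of_false h1 h2
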